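/- Let q be a prime power of characteristic p, let n be an integer with 3 ≤ n ≤ p, and let e be a divisor of q−1. If Rad(e) = Rad(q−1) set s = 0 and δ = 1; otherwise let p_1, …, p_s (s ≥ 1) be the distinct primes dividing q−1 but not e and set δ = 1 − n Σ_{i=1}^{s} 1/p_i. Assume δ > 0. If moreover q > ((n−1)((ns − 1)/δ + 2) W(e)^n)^2, then 𝔽_q contains n consecutive primitive elements. -/

import Mathlib

open Finset

/-- An element `g` of a finite field is primitive if it generates the multiplicative
group of nonzero elements, i.e. every nonzero element is a power of `g`. -/
def IsPrimitiveElem {F : Type*} [Field F] (g : F) : Prop :=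
  ∀ x : F, x ≠ 0 → ∃ k : ℕ, g ^ k = x

/-- The field `F` contains `n` consecutive distinct primitive elements: there is `g`
such that `g, g+1, …, g+n-1` are `n` distinct primitive elements. -/
def HasConsecutivePrimitives (F : Type*) [Field F] (n : ℕ) : Prop :=
  ∃ g : F, (∀ k : ℕ, k < n → IsPrimitiveElem (g + (k : F))) ∧
    ∀ i : ℕ, i < n → ∀ j : ℕ, j < n → g + (i : F) = g + (j : F) → i = j

/-- A nonzero element `g` is `e`-free if `g = h ^ d` with `d ∣ e` forces `d = 1`. -/
def EFree {F : Type*} [Field F] (e : ℕ) (g : F) : Prop :=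
  g ≠ 0 ∧ ∀ (h : F) (d : ℕ), d ∣ e → g = h ^ d → d = 1

/-- `Ncount F n e` is the number `N(e₁, …, eₙ)` of `g ∈ F` such that `g + k - 1`
is `eₖ`-free for each `k = 1, …, n`. -/
noncomputable def Ncount (F : Type*) [Field F] (n : ℕ) (e : Fin n → ℕ) : ℕ :=
  Nat.card {g : F // ∀ k : Fin n, EFree (e k) (g + ((k : ℕ) : F))}

/-- `Nn F n e = N(e, …, e)` counts `g ∈ F` with `g, g+1, …, g+n-1` all `e`-free. -/
noncomputable def Nn (F : Type*) [Field F] (n e : ℕ) : ℕ :=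
  Ncount F n (fun _ => e)

/-- `θ(m) = ∏_{ℓ ∣ m, ℓ prime} (1 - 1/ℓ)`. -/
noncomputable def theta (m : ℕ) : ℝ :=
  ∏ l ∈ m.primeFactors, (1 - 1 / (l : ℝ))

/-- `W(m) = 2^{ω(m)}`, the number of squarefree divisors of `m`. -/
def W (m : ℕ) : ℕ := 2 ^ m.primeFactors.card

section Nonvanishing
open Polynomial

/-- A polynomial of degree `< D` is coprime to `X ^ D - θ` as soon as no power `θ ^ r` with
`0 < r < D` is a `D`-th power. -/
lemma isCoprime_X_pow_sub_C_of_pow_ne {E : Type*} [Field E] {D : ℕ} {θ : E}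
    (H : ∀ r, 0 < r → r < D → ∀ c : E, c ^ D ≠ θ ^ r) {h : E[X]} (h0 : h ≠ 0)
    (hd : h.natDegree < D) : IsCoprime h (X ^ D - C θ) := by
  refine isCoprime_of_irreducible_dvd (fun hh => h0 hh.1) fun z hz hzh hzk => ?_
  have hz0 := hz.ne_zero
  set u : E[X] := z * C z.leadingCoeff⁻¹ with hu
  have hum : u.Monic := monic_mul_leadingCoeff_inv hz0
  have hudeg : u.natDegree = z.natDegree := natDegree_mul_leadingCoeff_inv z hz0
  have huk : u ∣ X ^ D - C θ := by
    have : IsUnit (C z.leadingCoeff⁻¹ : E[X]) := by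
      rw [isUnit_C]; exact (inv_ne_zero (leadingCoeff_ne_zero.2 hz0)).isUnit
    exact (this.mul_right_dvd).2 hzk
  have hr0 : 0 < u.natDegree := hudeg ▸ hz.natDegree_pos
  have hrD : u.natDegree < D := hudeg ▸ (natDegree_le_of_dvd hzh h0).trans_lt hd
  refine H _ hr0 hrD ((-1) ^ u.natDegree * u.coeff 0) ?_
  let i := algebraMap E (AlgebraicClosure E)
  apply i.injective
  have hs : (u.map i).Splits := IsAlgClosed.splits _
  have hcoeff := hs.coeff_zero_eq_prod_roots_of_monic (hum.map i)
  rw [natDegree_map, coeff_map] at hcoeff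
  have hroots : ∀ ρ ∈ (u.map i).roots, ρ ^ D = i θ := by
    intro ρ hρ
    have h1 : (u.map i).IsRoot ρ := isRoot_of_mem_roots hρ
    have h2 : ((X ^ D - C θ).map i).IsRoot ρ := h1.dvd (Polynomial.map_dvd i huk)
    simpa [sub_eq_zero] using h2
  have hcard : (u.map i).roots.card = u.natDegree := by
    rw [← hs.natDegree_eq_card_roots, natDegree_map]
  have hone : ((-1 : AlgebraicClosure E) ^ u.natDegree) * (-1) ^ u.natDegree = 1 := by
    rw [← mul_pow]; simp
  rw [map_pow, map_mul, hcoeff, map_pow, map_pow, map_neg, map_one, ← mul_assoc, hone, one_mul,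
    ← Multiset.map_id (u.map i).roots, ← Multiset.prod_map_pow,
    (Multiset.map_congr rfl hroots : Multiset.map (fun ρ => id ρ ^ D) _ = _),
    Multiset.map_const', Multiset.prod_replicate, hcard]

lemma natDegree_det_le {S : Type*} [CommRing S] {ι : Type*} [Fintype ι] [DecidableEq ι]
    (A : Matrix ι ι S[X]) (d : ℕ) (hA : ∀ i j, (A i j).natDegree ≤ d) :
    A.det.natDegree ≤ Fintype.card ι * d := by
  rw [Matrix.det_apply]
  refine natDegree_sum_le_of_forall_le _ _ fun σ _ => ?_
  refine (natDegree_smul_le _ _).trans ((natDegree_prod_le _ _).trans ?_)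
  exact (Finset.sum_le_card_nsmul _ _ d fun i _ => hA _ _).trans (by simp)

lemma natDegree_resultant_le {S : Type*} [CommRing S] (f g : S[X][X]) (m n d : ℕ)
    (hf : ∀ i, (f.coeff i).natDegree ≤ d) (hg : ∀ i, (g.coeff i).natDegree ≤ d) :
    (resultant f g m n).natDegree ≤ (m + n) * d := by
  have := natDegree_det_le (sylvester f g m n) d ?_
  · simpa [resultant] using this
  · intro i j
    induction j using Fin.addCases with
    | left j => simp only [sylvester, Matrix.of_apply, Fin.addCases_left]; split_ifs <;> simp [hg]
    | right j => simp only [sylvester, Matrix.of_apply, Fin.addCases_right]; split_ifs <;> simp [hf]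

/-- The substitution `(x, t) ↦ (x, x ^ P)`, where `t` is the inner variable of `F[t][x]`. -/
noncomputable def substPow (F : Type*) [Field F] (P : ℕ) : F[X][X] →+* F[X] :=
  eval₂RingHom (expand F P : F[X] →+* F[X]) X

lemma substPow_ne_zero {F : Type*} [Field F] {P : ℕ} {r : F[X][X]} (hr : r ≠ 0)
    (hdeg : r.natDegree < P) : substPow F P r ≠ 0 := by
  intro h0
  apply hr
  ext t s
  rw [coeff_zero, coeff_zero]
  by_cases ht : P ≤ t
  · rw [coeff_eq_zero_of_natDegree_lt (hdeg.trans_le ht), coeff_zero]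
  push Not at ht
  have hP : 0 < P := by omega
  have h1 : (substPow F P r).coeff (s * P + t) = 0 := by rw [h0, coeff_zero]
  rw [substPow, coe_eval₂RingHom, eval₂_eq_sum_range' _ hdeg, finsetSum_coeff] at h1
  rw [← h1, Finset.sum_eq_single t]
  · simp [coeff_mul_X_pow', coeff_expand hP, hP]
  · intro b hb hbt
    rw [Finset.mem_range] at hb
    rw [coeff_mul_X_pow']
    split_ifs with hle
    · simp only [RingHom.coe_coe, coeff_expand hP]
      rw [if_neg]
      intro hdvd
      have h2 : (b : ℤ) ≡ t [ZMOD P] := by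
        rw [Int.modEq_iff_dvd]
        have : ((P : ℕ) : ℤ) ∣ ((s * P + t - b : ℕ) : ℤ) := by exact_mod_cast hdvd
        rw [Nat.cast_sub hle] at this
        push_cast at this
        rw [show (t : ℤ) - b = s * P + t - b - s * P by ring]
        exact this.sub (dvd_mul_left (P : ℤ) (s : ℤ))
      have h3 : b ≡ t [MOD P] := (Int.natCast_modEq_iff).1 h2
      exact hbt (Nat.ModEq.eq_of_lt_of_lt h3 hb ht)
    · rfl
  · intro h; exact absurd (Finset.mem_range.2 ht) h

lemma expand_card_pow {F : Type*} [Field F] [Fintype F] (h : ℕ) (f : F[X]) :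
    expand F (Fintype.card F ^ h) f = f ^ (Fintype.card F ^ h) := by
  induction h with
  | zero => simp
  | succ k ih => rw [pow_succ', expand_mul, ih, map_pow, FiniteField.expand_card, ← pow_mul]

/-- Nonvanishing of the auxiliary polynomial of Stepanov's method. -/
lemma auxiliary_ne_zero {F : Type*} [Field F] [Fintype F] {f : F[X]} (hf : f ≠ 0) {D h m l : ℕ}
    (hD : 0 < D) (hDP : D ∣ Fintype.card F ^ h - 1)
    (hirr : ∀ r, 0 < r → r < D → ∀ u w : F[X][X], w ≠ 0 →
      u ^ D * (f.map C) ^ r ≠ w ^ D * (C f) ^ r)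
    (a : Fin D → Fin m → F[X]) (ha : ∀ j i, (a j i).natDegree < l) (hfl : f.natDegree ≤ l)
    (hl : 2 * D * l < Fintype.card F ^ h) (hne : a ≠ 0) :
    ∑ j, ∑ i, a j i * (f ^ ((Fintype.card F ^ h - 1) / D)) ^ (j : ℕ) *
      X ^ ((i : ℕ) * Fintype.card F ^ h) ≠ 0 := by
  set P := Fintype.card F ^ h with hP
  set g := f ^ ((P - 1) / D) with hg
  intro h0
  have hPpos : 0 < P := by omega
  let H : Fin D → F[X][X] := fun j => ∑ i, (a j i).map C * C (X ^ (i : ℕ))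
  let hh : F[X][X][X] := ∑ j, C (H j) * X ^ (j : ℕ)
  let k : F[X][X][X] := C (f.map C) * X ^ D - C (C f)
  have hhcoeff : ∀ j : Fin D, hh.coeff j = H j := by
    intro j
    simp only [hh, finsetSum_coeff, coeff_C_mul_X_pow]
    rw [Finset.sum_eq_single j]
    · simp
    · intro b _ hb; rw [if_neg]; intro h; exact hb (Fin.ext h.symm)
    · simp
  have hhdeg : hh.natDegree < D := by
    refine lt_of_le_of_lt (natDegree_sum_le_of_forall_le (n := D - 1) _ _ fun j _ => ?_) (by omega)
    exact (natDegree_C_mul_X_pow_le _ _).trans (by omega)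
  have hHdeg : ∀ j, (H j).natDegree ≤ l := by
    intro j
    refine natDegree_sum_le_of_forall_le _ _ fun i _ => ?_
    exact (natDegree_mul_C_le _ _).trans (natDegree_map_le.trans (ha j i).le)
  have hfC : f.map (C : F →+* F[X]) ≠ 0 := (Polynomial.map_ne_zero_iff C_injective).2 hf
  have hhne : hh ≠ 0 := by
    intro hz
    apply hne
    funext j i
    have h1 : H j = 0 := by rw [← hhcoeff, hz, coeff_zero]
    ext t
    have h2 : ((H j).coeff t).coeff i = 0 := by rw [h1]; simp
    simp only [H, finsetSum_coeff, coeff_mul_C, coeff_map, coeff_C_mul_X_pow] at h2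
    rw [Finset.sum_eq_single i] at h2
    · simpa using h2
    · intro b _ hb; rw [if_neg]; intro h; exact hb (Fin.ext h.symm)
    · simp
  have hkdeg : k.natDegree = D := by
    simp only [k]
    rw [natDegree_sub_C, natDegree_C_mul_X_pow _ _ hfC]
  let E := FractionRing F[X][X]
  let i : F[X][X] →+* E := algebraMap _ _
  have hi : Function.Injective i := IsFractionRing.injective _ _
  have hifC : i (f.map C) ≠ 0 := (map_ne_zero_iff i hi).2 hfC
  have hcop : IsCoprime (hh.map i) (k.map i) := by
    have h1 : k.map i = C (i (f.map C)) * (X ^ D - C (i (C f) / i (f.map C))) := by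
      simp only [k, Polynomial.map_sub, Polynomial.map_mul, map_C, Polynomial.map_pow, map_X]
      rw [mul_sub, ← C_mul, mul_div_cancel₀ _ hifC]
    rw [h1]
    refine (isCoprime_mul_unit_left_right (isUnit_C.2 hifC.isUnit) _ _).2 ?_
    refine isCoprime_X_pow_sub_C_of_pow_ne ?_ ((Polynomial.map_ne_zero_iff hi).2 hhne)
      (by rwa [natDegree_map_eq_of_injective hi])
    intro r hr hrD c hc
    obtain ⟨u, w, hw, rfl⟩ := IsFractionRing.div_surjective (A := F[X][X]) c
    have hw0 : w ≠ 0 := nonZeroDivisors.ne_zero hw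
    have hiw : i w ≠ 0 := (map_ne_zero_iff i hi).2 hw0
    refine hirr r hr hrD u w hw0 (hi ?_)
    rw [div_pow, div_pow, div_eq_div_iff (pow_ne_zero _ hiw) (pow_ne_zero _ hifC)] at hc
    simp only [map_mul, map_pow]
    rw [hc, mul_comm]
  have hres : resultant hh k ≠ 0 := by
    intro hz
    have h1 : resultant (hh.map i) (k.map i) = 0 := by
      rw [natDegree_map_eq_of_injective hi, natDegree_map_eq_of_injective hi, resultant_map_map,
        hz, map_zero]
    exact (resultant_eq_zero_iff.1 h1).2 hcop
  have hresdeg : (resultant hh k).natDegree < P := by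
    refine (natDegree_resultant_le hh k _ _ l ?_ ?_).trans_lt ?_
    · intro j
      by_cases hj : j < D
      · exact (congrArg natDegree (hhcoeff ⟨j, hj⟩)).trans_le (hHdeg _)
      · rw [coeff_eq_zero_of_natDegree_lt (by omega)]; simp
    · intro j
      simp only [k, coeff_sub, coeff_C_mul_X_pow, coeff_C]
      refine (natDegree_sub_le _ _).trans (max_le ?_ ?_)
      · split_ifs
        · exact natDegree_map_le.trans hfl
        · simp
      · split_ifs <;> simp
    · rw [hkdeg]
      exact (Nat.mul_le_mul_right l (by omega : hh.natDegree + D ≤ 2 * D)).trans_lt hl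
  obtain ⟨p, q, -, -, hpq⟩ := exists_mul_add_mul_eq_C_resultant hh k le_rfl le_rfl
    (Or.inr (by rw [hkdeg]; omega))
  refine substPow_ne_zero hres hresdeg ?_
  have hsub : ∀ b : F[X], substPow F P (b.map C) = b := by
    intro b
    simp only [substPow, coe_eval₂RingHom, eval₂_map]
    conv_rhs => rw [← eval₂_C_X (p := b)]
    congr 1
    ext t
    simp
  have hsubC : ∀ b : F[X], substPow F P (C b) = expand F P b := by
    intro b; simp [substPow]
  have h1 := congrArg (eval₂ (substPow F P) g) hpq
  rw [eval₂_add, eval₂_mul, eval₂_mul, eval₂_C] at h1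
  rw [← h1]
  have h2 : eval₂ (substPow F P) g hh = 0 := by
    have hH : ∀ j, substPow F P (H j) = ∑ i, a j i * X ^ ((i : ℕ) * P) := by
      intro j
      simp only [H, map_sum, map_mul, hsub, hsubC]
      refine Finset.sum_congr rfl fun i _ => ?_
      rw [map_pow, expand_X, ← pow_mul, mul_comm P]
    rw [← h0]
    simp only [hh, eval₂_finsetSum, eval₂_mul, eval₂_C, eval₂_X_pow, hH, Finset.sum_mul]
    exact Finset.sum_congr rfl fun j _ => Finset.sum_congr rfl fun i _ => by ring
  have h3 : eval₂ (substPow F P) g k = 0 := by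
    simp only [k, eval₂_sub, eval₂_mul, eval₂_C, eval₂_X_pow, hsub, hsubC]
    rw [hP, expand_card_pow, ← hP, hg, ← pow_mul, Nat.div_mul_cancel hDP, ← pow_succ',
      Nat.sub_add_cancel hPpos, sub_self]
  rw [h2, h3]; ring

end Nonvanishing

section Stepanov
open Polynomial

/-- For a product of powers of distinct linear factors with exponents jointly coprime to `D`,
the quotient `f(t) / f(x)` has no `r`-th power which is a `D`-th power for `0 < r < D`. -/
lemma pow_mul_prod_linear_ne {F ι : Type*} [Field F] [Fintype ι] {a : ι → F}
    (ha : Function.Injective a) {D : ℕ} {m : ι → ℕ} (hm : ∀ r, (∀ i, D ∣ r * m i) → D ∣ r)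
    {r : ℕ} (hr : 0 < r) (hrD : r < D) (u w : F[X][X]) (hw : w ≠ 0) :
    u ^ D * ((∏ i, (C (a i) - X) ^ m i).map C) ^ r ≠ w ^ D * (C (∏ i, (C (a i) - X) ^ m i)) ^ r := by
  classical
  intro heq
  refine absurd (hm r fun i => ?_) (Nat.not_dvd_of_pos_of_lt hr hrD)
  have hlin : ∀ b : F, (C b - X : F[X]) ≠ 0 := fun b => by
    rw [← neg_ne_zero, neg_sub]; exact X_sub_C_ne_zero b
  have hp : Prime (C (a i) - X : F[X]) := by
    have := (prime_X_sub_C (a i)).neg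
    rwa [neg_sub] at this
  have hπ : Prime (C (C (a i) - X) : F[X][X]) := prime_C_iff.2 hp
  set π : F[X][X] := C (C (a i) - X) with hπdef
  have hf0 : (∏ i, (C (a i) - X) ^ m i : F[X]) ≠ 0 :=
    Finset.prod_ne_zero_iff.2 fun j _ => pow_ne_zero _ (hlin _)
  have hu : u ≠ 0 := by
    rintro rfl
    rw [zero_pow (by omega), zero_mul] at heq
    exact mul_ne_zero (pow_ne_zero _ hw) (pow_ne_zero _ (C_ne_zero.2 hf0)) heq.symm
  have e1 : emultiplicity π ((∏ i, (C (a i) - X) ^ m i).map C) = 0 := by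
    rw [emultiplicity_eq_zero]
    intro hd
    rw [Polynomial.map_prod] at hd
    obtain ⟨j, -, hj⟩ := (hπ.dvd_finsetProd_iff _).1 hd
    rw [Polynomial.map_pow, Polynomial.map_sub, map_C, map_X] at hj
    have h1 := (C_dvd_iff_dvd_coeff _ _).1 (hπ.dvd_of_dvd_pow hj) 1
    simp only [coeff_sub, coeff_C_succ, coeff_X_one, zero_sub] at h1
    exact hp.not_isUnit (isUnit_of_dvd_unit h1 isUnit_one.neg)
  have e2 : emultiplicity π (C (∏ i, (C (a i) - X) ^ m i)) = m i := by
    rw [map_prod, Finset.emultiplicity_prod hπ, Finset.sum_eq_single i]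
    · rw [map_pow, emultiplicity_pow_self_of_prime hπ]
    · intro j _ hj
      rw [emultiplicity_eq_zero]
      intro hd
      rw [map_pow] at hd
      have h1 := (C_dvd_iff_dvd_coeff _ _).1 (hπ.dvd_of_dvd_pow hd) 0
      rw [coeff_C_zero] at h1
      obtain ⟨t, ht⟩ := h1
      have h2 := congrArg (eval (a i)) ht
      simp only [eval_sub, eval_C, eval_X, eval_mul, sub_self, zero_mul] at h2
      exact hj (ha (sub_eq_zero.1 h2))
    · simp
  have h1 := congrArg (emultiplicity π) heq
  rw [emultiplicity_mul hπ, emultiplicity_mul hπ, emultiplicity_pow hπ, emultiplicity_pow hπ,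
    emultiplicity_pow hπ, emultiplicity_pow hπ, e1, e2,
    (FiniteMultiplicity.of_prime_left hπ hu).emultiplicity_eq_multiplicity,
    (FiniteMultiplicity.of_prime_left hπ hw).emultiplicity_eq_multiplicity, mul_zero, add_zero] at h1
  have h2 : D * multiplicity π u = D * multiplicity π w + r * m i := by exact_mod_cast h1
  exact (Nat.dvd_add_right (dvd_mul_right D _)).1 (h2 ▸ dvd_mul_right D _)

/-- Stepanov's upper bound for the number of points with a prescribed power residue class. -/
lemma card_residue_class_le {F K : Type*} [Field F] [Fintype F] [Field K] [Fintype K]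
    [Algebra F K] [DecidableEq K] {f : F[X]} {D h m l : ℕ}
    (hK : Fintype.card K = (Fintype.card F ^ h) ^ 2)
    (hD : 0 < D) (hDP : D ∣ Fintype.card F ^ h - 1)
    (hirr : ∀ r, 0 < r → r < D → ∀ u w : F[X][X], w ≠ 0 →
      u ^ D * (f.map C) ^ r ≠ w ^ D * (C f) ^ r)
    (hfl : f.natDegree ≤ l) (hl : 2 * D * l < Fintype.card F ^ h)
    (hdim : (l + f.natDegree) * Fintype.card F ^ h + m < D * m * l) (c : F) (hc : c ≠ 0) :
    #{x : K | (aeval x f) ^ ((Fintype.card K - 1) / D) = algebraMap F K c} ≤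
      l + f.natDegree * Fintype.card F ^ h + (m - 1) * Fintype.card F ^ h := by
  set P := Fintype.card F ^ h with hP
  set M := f.natDegree with hM
  set g := f ^ ((P - 1) / D) with hg
  have hPpos : 0 < P := by omega
  by_cases hf : f = 0
  · rw [Finset.card_eq_zero.2]; · omega
    refine Finset.filter_eq_empty_iff.2 fun x _ hx => ?_
    rw [hf, map_zero] at hx
    by_cases h0 : (Fintype.card K - 1) / D = 0
    · have h1 : D ∣ Fintype.card K - 1 := by
        rw [hK]
        exact hDP.trans (by simpa using Nat.sub_dvd_pow_sub_pow P 1 2)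
      have h2 : 1 < Fintype.card K := Fintype.one_lt_card
      have := Nat.div_pos (Nat.le_of_dvd (by omega) h1) hD
      omega
    · rw [zero_pow h0] at hx
      exact hc ((map_eq_zero _).1 hx.symm)
  have hgdeg : g.natDegree ≤ M * ((P - 1) / D) := by
    rw [hg, mul_comm]; exact natDegree_pow_le
  have hdiv : (P - 1) / D * D = P - 1 := Nat.div_mul_cancel hDP
  have hgpow : ∀ t, t < D → (g ^ t).natDegree ≤ M * P := by
    intro t ht
    refine natDegree_pow_le.trans ((Nat.mul_le_mul ht.le hgdeg).trans ?_)
    calc D * (M * ((P - 1) / D)) = M * ((P - 1) / D * D) := by ring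
      _ ≤ M * P := by rw [hdiv]; exact Nat.mul_le_mul_left _ (Nat.sub_le _ _)
  let Ψ : (Fin D → Fin m → degreeLT F l) →ₗ[F] F[X] :=
    { toFun := fun a => ∑ j, ∑ i, expand F P (a j i : F[X]) *
        (C (c ^ (j : ℕ)) * g ^ (D - 1 - j) * X ^ (i : ℕ))
      map_add' := fun a b => by simp [add_mul, Finset.sum_add_distrib]
      map_smul' := fun r a => by simp [Finset.smul_sum] }
  have hΨa : ∀ a, Ψ a = ∑ j, ∑ i, expand F P (a j i : F[X]) *
      (C (c ^ (j : ℕ)) * g ^ (D - 1 - j) * X ^ (i : ℕ)) := fun a => rfl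
  have hlt : ∀ p ∈ degreeLT F l, p.natDegree < l := by
    intro p hp
    by_cases hp0 : p = 0
    · rw [hp0, natDegree_zero]
      by_contra hl0
      have : l = 0 := by omega
      simp [this] at hdim
    · exact (natDegree_lt_iff_degree_lt hp0).2 (mem_degreeLT.1 hp)
  have hΨ : ∀ a, Ψ a ∈ degreeLT F ((l + M) * P + m) := by
    intro a
    rw [hΨa]
    refine Submodule.sum_mem _ fun j _ => Submodule.sum_mem _ fun i _ => ?_
    rw [mem_degreeLT]
    refine degree_le_natDegree.trans_lt ?_
    rw [Nat.cast_lt]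
    refine (natDegree_mul_le (R := F)).trans_lt ?_
    have h1 : (expand F P (a j i : F[X])).natDegree ≤ l * P := by
      rw [natDegree_expand]; exact Nat.mul_le_mul_right _ (hlt _ (a j i).2).le
    have h2 : (C (c ^ (j : ℕ)) * g ^ (D - 1 - j) * X ^ (i : ℕ) : F[X]).natDegree ≤ M * P + i := by
      refine (natDegree_mul_le (R := F)).trans (add_le_add ?_ (natDegree_X_pow_le (R := F) _))
      exact (natDegree_C_mul_le _ _).trans (hgpow _ (by omega))
    have := i.2
    rw [add_mul]; omega
  obtain ⟨a, haker, hane⟩ : ∃ a, Ψ a = 0 ∧ a ≠ 0 := by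
    have hfin : Module.finrank F (degreeLT F ((l + M) * P + m)) <
        Module.finrank F (Fin D → Fin m → degreeLT F l) := by
      rw [(degreeLTEquiv F _).finrank_eq, Module.finrank_pi_fintype]
      simp only [Module.finrank_pi_fintype, (degreeLTEquiv F _).finrank_eq, Module.finrank_self, mul_one,
        Fintype.card_fin, Finset.sum_const, Finset.card_univ, smul_eq_mul]
      rwa [← mul_assoc]
    have h1 := LinearMap.ker_ne_bot_of_finrank_lt (f := Ψ.codRestrict _ hΨ) hfin
    obtain ⟨a, ha, ha0⟩ := (Submodule.ne_bot_iff _).1 h1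
    exact ⟨a, by simpa using congrArg Subtype.val ha, ha0⟩
  set G : F[X] := ∑ j : Fin D, ∑ i : Fin m, (a j i : F[X]) * g ^ (j : ℕ) * X ^ ((i : ℕ) * P) with hG
  have hG0 : G ≠ 0 := by
    refine auxiliary_ne_zero hf hD hDP hirr (fun j i => (a j i : F[X]))
      (fun j i => hlt _ (a j i).2) hfl hl ?_
    intro h0
    apply hane
    funext j i
    exact Subtype.ext (congrFun (congrFun h0 j) i)
  have hGdeg : G.natDegree ≤ l + M * P + (m - 1) * P := by
    refine natDegree_sum_le_of_forall_le _ _ fun j _ =>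
      natDegree_sum_le_of_forall_le _ _ fun i _ => ?_
    refine (natDegree_mul_le (R := F)).trans (add_le_add (natDegree_mul_le.trans
      (add_le_add (hlt _ (a j i).2).le (hgpow _ j.2))) ((natDegree_X_pow_le (R := F) _).trans ?_))
    exact Nat.mul_le_mul_right _ (by omega)
  refine le_trans ?_ (hGdeg.trans' ((card_roots' (G.map (algebraMap F K))).trans_eq
    (natDegree_map _)))
  refine le_trans (Finset.card_le_card (t := (G.map (algebraMap F K)).roots.toFinset) ?_)
    (Multiset.toFinset_card_le _)
  intro x hx
  rw [Finset.mem_filter] at hx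
  rw [Multiset.mem_toFinset,
    mem_roots ((Polynomial.map_ne_zero_iff (algebraMap F K).injective).2 hG0), IsRoot.def,
    eval_map_algebraMap]
  have hxQ : (x ^ P) ^ P = x := by
    rw [← pow_mul, ← sq, ← hK, FiniteField.pow_card]
  set y := aeval x f with hy
  have hgx : aeval x g = y ^ ((P - 1) / D) := by rw [hg, map_pow]
  have hexp : (P - 1) / D * P + (P - 1) / D = (Fintype.card K - 1) / D := by
    rw [hK]
    symm
    apply Nat.div_eq_of_eq_mul_left hD
    rw [add_mul, mul_right_comm, hdiv]
    obtain ⟨k, hk⟩ := Nat.exists_eq_succ_of_ne_zero hPpos.ne'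
    rw [hk]; simp only [Nat.succ_eq_add_one, Nat.add_sub_cancel]
    rw [Nat.sub_eq_iff_eq_add (Nat.one_le_pow _ _ (by omega))]; ring
  have hgc : (aeval x g) ^ P * aeval x g = algebraMap F K c := by
    rw [hgx, ← pow_mul, ← pow_add, hexp]; exact hx.2
  have hg0 : aeval x g ≠ 0 := by
    intro h0
    rw [h0, mul_zero] at hgc
    exact hc ((map_eq_zero _).1 hgc.symm)
  have hchar : ∀ p : F[X], aeval x p ^ P = aeval (x ^ P) p := by
    intro p
    rw [← map_pow, hP, ← expand_card_pow, expand_aeval]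
  have key : (aeval x G) ^ P * (aeval x g) ^ (D - 1) = aeval x (Ψ a) := by
    rw [hchar]
    simp only [hG, hΨa, map_sum, map_mul, map_pow, aeval_X,
      expand_aeval, aeval_C, Finset.sum_mul]
    refine Finset.sum_congr rfl fun j _ => Finset.sum_congr rfl fun i _ => ?_
    rw [← hchar g, mul_comm (i : ℕ) P, pow_mul (x ^ P) P, hxQ, ← hgc,
      show D - 1 = j + (D - 1 - j) by omega, pow_add, mul_pow,
      show j + (D - 1 - j) - j = D - 1 - j by omega]
    ring
  rw [haker, map_zero] at key
  exact (pow_eq_zero_iff hPpos.ne').1 ((mul_eq_zero.1 key).resolve_right (pow_ne_zero _ hg0))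
end Stepanov

/-- A finite family of multiplicative characters consists of powers of a single character
of the smallest possible order. -/
lemma MulChar.exists_common_generator {F ι : Type*} [Field F] [Fintype F]
    (χ : ι → MulChar F ℂ) :
    ∃ (ψ : MulChar F ℂ) (m : ι → ℕ), (∀ i, m i ≠ 0) ∧ (∀ i, χ i = ψ ^ m i) ∧
      ∀ r, (∀ i, orderOf ψ ∣ r * m i) → orderOf ψ ∣ r := by
  classical
  have : IsCyclic (MulChar F ℂ) :=
    (MulChar.mulEquiv_units F ℂ).some.isCyclic.2 inferInstance
  set H := Subgroup.closure (Set.range χ)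
  obtain ⟨⟨ψ, hψ⟩, hgen⟩ := IsCyclic.exists_generator (α := H)
  have hpos := ψ.orderOf_pos
  have hχ : ∀ i, ∃ k : ℕ, k ≠ 0 ∧ χ i = ψ ^ k := by
    intro i
    have h1 : ψ ^ 0 ∈ Subgroup.zpowers ψ := one_mem _
    obtain ⟨z, hz⟩ := Subgroup.mem_zpowers_iff.1
      (hgen ⟨χ i, Subgroup.subset_closure (Set.mem_range_self i)⟩)
    have hz' : ψ ^ z = χ i := congrArg Subtype.val hz
    have h2 : χ i ∈ Submonoid.powers ψ :=
      mem_powers_iff_mem_zpowers.2 (Subgroup.mem_zpowers_iff.2 ⟨z, hz'⟩)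
    obtain ⟨k, hk⟩ := h2
    exact ⟨k + orderOf ψ, by omega, by rw [pow_add, pow_orderOf_eq_one, mul_one]; exact hk.symm⟩
  choose m hm0 hm using hχ
  refine ⟨ψ, m, hm0, hm, fun r hr => ?_⟩
  have h1 : H ≤ (powMonoidHom r : MulChar F ℂ →* MulChar F ℂ).ker := by
    rw [Subgroup.closure_le]
    rintro _ ⟨i, rfl⟩
    rw [SetLike.mem_coe, MonoidHom.mem_ker, powMonoidHom_apply, hm i, ← pow_mul, mul_comm]
    exact orderOf_dvd_iff_pow_eq_one.1 (hr i)
  exact orderOf_dvd_iff_pow_eq_one.2 (h1 hψ)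

/-- The value of a character of order `D` is determined by the `(q - 1) / D`-th power. -/
lemma MulChar.apply_eq_of_pow_eq {F : Type*} [Field F] [Fintype F] (ψ : MulChar F ℂ) {v w : F}
    (hw : w ≠ 0)
    (h : v ^ ((Fintype.card F - 1) / orderOf ψ) = w ^ ((Fintype.card F - 1) / orderOf ψ)) :
    ψ v = ψ w := by
  classical
  have hpos := ψ.orderOf_pos
  have hdvd := ψ.orderOf_dvd_card_sub_one
  have h2 : 1 < Fintype.card F := Fintype.one_lt_card
  have hE : 0 < (Fintype.card F - 1) / orderOf ψ :=
    Nat.div_pos (Nat.le_of_dvd (by omega) hdvd) hpos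
  set E := (Fintype.card F - 1) / orderOf ψ with hEdef
  have hED : E * orderOf ψ = Fintype.card F - 1 := Nat.div_mul_cancel hdvd
  have hv : v ≠ 0 := by
    rintro rfl
    rw [zero_pow hE.ne'] at h
    exact pow_ne_zero _ hw h.symm
  set u : Fˣ := Units.mk0 v hv * (Units.mk0 w hw)⁻¹ with hu
  have hu1 : u ^ E = 1 := by
    ext
    simp only [hu, Units.val_pow_eq_pow_val, Units.val_mul, Units.val_mk0, Units.val_one,
      Units.val_inv_eq_inv_val, mul_pow, inv_pow, h]
    exact mul_inv_cancel₀ (pow_ne_zero _ hw)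
  obtain ⟨γ, hγ⟩ := IsCyclic.exists_monoid_generator (α := Fˣ)
  obtain ⟨t, ht⟩ := hγ u
  have hord : orderOf γ = Fintype.card F - 1 := by
    rw [orderOf_eq_card_of_forall_mem_zpowers
      (fun x => mem_powers_iff_mem_zpowers.1 (hγ x)), Nat.card_units, Nat.card_eq_fintype_card]
  simp only at ht
  rw [← ht, ← pow_mul, ← orderOf_dvd_iff_pow_eq_one, hord, ← hED, mul_comm t] at hu1
  have htD := Nat.dvd_of_mul_dvd_mul_left hE hu1
  obtain ⟨k, hk⟩ := htD
  have hvw : v = (γ : F) ^ t * w := by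
    rw [← Units.val_pow_eq_pow_val, ht, hu]; simp [hw]
  rw [hvw, map_mul, hk, pow_mul, map_pow]
  have : ψ ((γ : F) ^ orderOf ψ) = 1 := by
    rw [map_pow, ← ψ.pow_apply_coe, pow_orderOf_eq_one, MulChar.one_apply_coe]
  rw [this, one_pow, one_mul]

/-- If no residue class is overpopulated by `v`, the corresponding character sum is small. -/
lemma MulChar.norm_sum_le_of_card_le {F Y : Type*} [Field F] [Fintype F] [DecidableEq F]
    [Fintype Y] (ψ : MulChar F ℂ) (hψ : ψ ≠ 1) (v : Y → F) (U : ℕ)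
    (hU : ∀ w : Fˣ, #{y | v y ^ ((Fintype.card F - 1) / orderOf ψ) =
      (w : F) ^ ((Fintype.card F - 1) / orderOf ψ)} ≤ U) :
    ‖∑ y, ψ (v y)‖ ≤ orderOf ψ * U - #{y | v y ≠ 0} := by
  classical
  have hpos := ψ.orderOf_pos
  have hdvd := ψ.orderOf_dvd_card_sub_one
  have h2 : 1 < Fintype.card F := Fintype.one_lt_card
  have hE : 0 < (Fintype.card F - 1) / orderOf ψ :=
    Nat.div_pos (Nat.le_of_dvd (by omega) hdvd) hpos
  set E := (Fintype.card F - 1) / orderOf ψ with hEdef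
  have hED : E * orderOf ψ = Fintype.card F - 1 := Nat.div_mul_cancel hdvd
  have hcard1 : #{u : Fˣ | u ^ E = 1} = E := by
    have h1 := IsCyclic.card_powMonoidHom_ker Fˣ E
    rw [Nat.card_units, Nat.card_eq_fintype_card (α := F),
      Nat.gcd_eq_right ⟨orderOf ψ, hED.symm⟩] at h1
    rw [← Fintype.card_subtype, Fintype.card_eq_nat_card]
    exact h1
  have hcard : ∀ y, #{w : Fˣ | v y ^ E = (w : F) ^ E} = if v y ≠ 0 then E else 0 := by
    intro y
    split_ifs with h
    · refine Eq.trans ?_ hcard1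
      refine Finset.card_bij (fun w _ => w * (Units.mk0 _ h)⁻¹) ?_ (by simp) ?_
      · intro w hw
        simp only [Finset.mem_filter, Finset.mem_univ, true_and] at hw ⊢
        rw [mul_pow, inv_pow, mul_inv_eq_one]
        ext
        simpa using hw.symm
      · intro u hu
        simp only [Finset.mem_filter, Finset.mem_univ, true_and] at hu
        refine ⟨u * Units.mk0 _ h, ?_, by simp⟩
        simp only [Finset.mem_filter, Finset.mem_univ, true_and, Units.val_mul, mul_pow,
          Units.val_mk0]
        rw [← Units.val_pow_eq_pow_val, hu, Units.val_one, one_mul]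
    · rw [Finset.card_eq_zero, Finset.filter_eq_empty_iff]
      intro w _ hw
      rw [not_not] at h
      rw [h, zero_pow hE.ne'] at hw
      exact pow_ne_zero E w.ne_zero hw.symm
  set N : Fˣ → ℕ := fun w => #{y | v y ^ E = (w : F) ^ E} with hN
  have hsum0 : ∑ w : Fˣ, ψ (w : F) = 0 := by
    rw [← MulChar.sum_eq_zero_of_ne_one hψ, ← Finset.sum_subset
      (Finset.subset_univ (Finset.univ.map ⟨fun w : Fˣ => (w : F), Units.val_injective⟩))]
    · simp
    · intro x _ hx
      apply ψ.map_nonunit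
      rintro ⟨u, rfl⟩
      simp at hx
  have hsumN : (E : ℂ) * ∑ y, ψ (v y) = ∑ w : Fˣ, ψ (w : F) * N w := by
    have : ∀ w : Fˣ, ψ (w : F) * N w = ∑ y, if v y ^ E = (w : F) ^ E then ψ (v y) else 0 := by
      intro w
      rw [← Finset.sum_filter, Finset.sum_congr rfl (g := fun _ => ψ (w : F))]
      · simp [hN, mul_comm]
      · intro y hy
        exact ψ.apply_eq_of_pow_eq w.ne_zero (Finset.mem_filter.1 hy).2
    simp_rw [this]
    rw [Finset.sum_comm, Finset.mul_sum]
    refine Finset.sum_congr rfl fun y _ => ?_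
    rw [← Finset.sum_filter, Finset.sum_const, hcard, nsmul_eq_mul]
    split_ifs with h
    · rfl
    · rw [not_not] at h
      simp [h]
  have hcountN : ∑ w : Fˣ, (N w : ℝ) = E * #{y | v y ≠ 0} := by
    have : ∑ w : Fˣ, N w = E * #{y | v y ≠ 0} := by
      simp_rw [hN, Finset.card_filter]
      rw [Finset.sum_comm, Finset.mul_sum]
      refine Finset.sum_congr rfl fun y _ => ?_
      rw [← Finset.card_filter, hcard]
      simp
    exact_mod_cast this
  have hmain : (E : ℂ) * ∑ y, ψ (v y) = - ∑ w : Fˣ, ψ (w : F) * ((U - N w : ℝ) : ℂ) := by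
    rw [hsumN]
    push_cast
    simp_rw [mul_sub]
    rw [Finset.sum_sub_distrib, ← Finset.sum_mul, hsum0]
    simp
  have hb : (E : ℝ) * ‖∑ y, ψ (v y)‖ ≤ ∑ w : Fˣ, (U - N w : ℝ) := by
    have h1 : (E : ℝ) * ‖∑ y, ψ (v y)‖ = ‖(E : ℂ) * ∑ y, ψ (v y)‖ := by simp
    rw [h1, hmain, norm_neg]
    refine (norm_sum_le _ _).trans (Finset.sum_le_sum fun w _ => ?_)
    have h2 : (0 : ℝ) ≤ U - N w := sub_nonneg.2 (by exact_mod_cast hU w)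
    have h3 : ‖ψ (w : F)‖ = 1 := by
      have h4 : ψ (w : F) ^ orderOf ψ = 1 := by
        rw [← ψ.pow_apply_coe, pow_orderOf_eq_one, MulChar.one_apply_coe]
      exact Complex.norm_eq_one_of_pow_eq_one h4 hpos.ne'
    rw [norm_mul, h3, one_mul, Complex.norm_real, Real.norm_of_nonneg h2]
  rw [Finset.sum_sub_distrib, hcountN, Finset.sum_const, Finset.card_univ, Fintype.card_units,
    ← hED, nsmul_eq_mul] at hb
  push_cast at hb
  have hE' : (0 : ℝ) < E := by exact_mod_cast hE
  rw [mul_assoc, ← mul_sub] at hb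
  exact le_of_mul_le_mul_left hb hE'

section Stepanov
open Polynomial

/-- Admissible parameters for Stepanov's method. -/
lemma exists_stepanov_parameters {D M P : ℕ} (hD : 0 < D) (hDP : D ∣ P - 1)
    (hP : 4 * D * (M + 1) + (8 * M + 24) < P) :
    ∃ m l : ℕ, M ≤ l ∧ 2 * D * l < P ∧ (l + M) * P + m < D * m * l ∧
      D * (l + M * P + (m - 1) * P) ≤ P ^ 2 + (1 + D * M + D * (8 * M + 24)) * P := by
  obtain ⟨k, hk⟩ := hDP
  have hP1 : P = D * k + 1 := by omega
  refine ⟨k + (8 * M + 24), P / (4 * D), ?_, ?_, ?_, ?_⟩ <;>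
  obtain ⟨t, ht⟩ : ∃ t, P % (4 * D) = t := ⟨_, rfl⟩ <;>
  have h1 := Nat.div_add_mod P (4 * D) <;>
  have h2 := Nat.mod_lt P (show 0 < 4 * D by omega) <;>
  set l := P / (4 * D) with hl <;>
  rw [ht] at h1 h2 <;>
  clear_value l
  · by_contra hlt
    have : 4 * D * (l + 1) ≤ 4 * D * M := Nat.mul_le_mul_left _ (by omega)
    nlinarith
  · nlinarith
  · have hl1 : 1 ≤ l := by
      by_contra hlt
      have : l = 0 := by omega
      subst this
      nlinarith
    have h8 : P ≤ 8 * D * l := by nlinarith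
    have hlP : l ≤ P := by nlinarith
    have hkP : k ≤ P := by nlinarith
    have h3 : D * (k + (8 * M + 24)) * l = P * l - l + (M + 3) * (8 * D * l) := by
      rw [hP1, add_mul, one_mul, Nat.add_sub_cancel]; ring
    have h4 : (M + 3) * P ≤ (M + 3) * (8 * D * l) := Nat.mul_le_mul_left _ h8
    have h5 : l ≤ P * l := by nlinarith
    have h6 : (l + M) * P = P * l + M * P := by ring
    have h7 : (M + 3) * P = M * P + 3 * P := by ring
    have h8 : 8 * M + 24 < P := by omega
    rw [h3, h6]
    omega
  · have h4 : k + (8 * M + 24) - 1 ≤ k + (8 * M + 24) := Nat.sub_le _ _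
    have hl4 : D * l ≤ P := by nlinarith
    calc D * (l + M * P + (k + (8 * M + 24) - 1) * P)
        ≤ D * (l + M * P + (k + (8 * M + 24)) * P) := by gcongr
      _ = D * l + D * M * P + (D * k) * P + D * (8 * M + 24) * P := by ring
      _ ≤ P + D * M * P + P * P + D * (8 * M + 24) * P := by
        gcongr; omega
      _ = _ := by ring

/-- Square-root cancellation, up to a constant, over all large extensions of even degree. -/
lemma exists_norm_charSum_le {F ι : Type*} [Field F] [Fintype F] [Fintype ι] {a : ι → F}
    (ha : Function.Injective a) {χ : ι → MulChar F ℂ} (hχ : ∃ i, χ i ≠ 1) :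
    ∃ (A : ℝ) (h₀ : ℕ), ∀ h ≥ h₀, ∀ (K : Type) [Field K] [Fintype K] [Algebra F K],
      Fintype.card K = (Fintype.card F ^ h) ^ 2 →
      ‖∑ y : K, ∏ i, χ i (Algebra.norm F (algebraMap F K (a i) - y))‖ ≤
        A * Fintype.card F ^ h := by
  classical
  obtain ⟨ψ, m, hm0, hψm, hm⟩ := MulChar.exists_common_generator χ
  have hψ : ψ ≠ 1 := by
    rintro rfl
    obtain ⟨i, hi⟩ := hχ
    exact hi (by rw [hψm i, one_pow])
  set D := orderOf ψ with hDdef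
  have hD : 0 < D := ψ.orderOf_pos
  have hDq : D ∣ Fintype.card F - 1 := ψ.orderOf_dvd_card_sub_one
  have hq : 1 < Fintype.card F := Fintype.one_lt_card
  set f : F[X] := ∏ i, (C (a i) - X) ^ m i with hf
  have hf0 : f ≠ 0 := Finset.prod_ne_zero_iff.2 fun j _ => pow_ne_zero _ (by
    rw [← neg_ne_zero, neg_sub]; exact X_sub_C_ne_zero _)
  set M := f.natDegree with hM
  refine ⟨(1 + D * M + D * (8 * M + 24) + M : ℕ), 4 * D * (M + 1) + (8 * M + 24), ?_⟩
  intro h hh K _ _ _ hK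
  set P := Fintype.card F ^ h with hP
  have hhP : h < P := Nat.lt_pow_self hq
  have hDP : D ∣ P - 1 := hDq.trans (by simpa using Nat.sub_dvd_pow_sub_pow (Fintype.card F) 1 h)
  obtain ⟨m', l, hMl, hl, hdim, hU⟩ := exists_stepanov_parameters hD hDP (hh.trans_lt hhP)
  have hval : ∀ y : K, ∏ i, χ i (Algebra.norm F (algebraMap F K (a i) - y)) =
      ψ (Algebra.norm F (aeval y f)) := by
    intro y
    rw [hf, map_prod, map_prod, map_prod]
    refine Finset.prod_congr rfl fun i _ => ?_
    rw [hψm i, ψ.pow_apply' (hm0 i), map_pow, map_pow, map_pow, map_sub (aeval (R := F) y), aeval_C, aeval_X]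
  simp_rw [hval]
  have hclass : ∀ w : Fˣ, #{y : K | Algebra.norm F (aeval y f) ^ ((Fintype.card F - 1) / D) =
      (w : F) ^ ((Fintype.card F - 1) / D)} ≤ l + M * P + (m' - 1) * P := by
    intro w
    refine le_trans (le_of_eq ?_) (card_residue_class_le hK hD hDP
      (fun r hr hrD u w hw => pow_mul_prod_linear_ne ha hm hr hrD u w hw) hMl hl hdim
      ((w : F) ^ ((Fintype.card F - 1) / D)) (pow_ne_zero _ w.ne_zero))
    congr 1
    ext y
    simp only [Finset.mem_filter, Finset.mem_univ, true_and]
    rw [← (algebraMap F K).injective.eq_iff, map_pow, FiniteField.algebraMap_norm_eq_pow,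
      ← pow_mul, Nat.card_eq_fintype_card, Nat.card_eq_fintype_card, ← Nat.mul_div_assoc _ hDq,
      Nat.div_mul_cancel]
    rw [hK, ← pow_mul]
    simpa using Nat.sub_dvd_pow_sub_pow (Fintype.card F) 1 (h * 2)
  have hmain := ψ.norm_sum_le_of_card_le hψ (fun y : K => Algebra.norm F (aeval y f)) _ hclass
  have hzero : #{y : K | Algebra.norm F (aeval y f) = 0} ≤ M := by
    have h1 : (f.map (algebraMap F K)).roots.card ≤ M :=
      (card_roots' _).trans_eq (natDegree_map _)
    refine le_trans (Finset.card_le_card (t := (f.map (algebraMap F K)).roots.toFinset) ?_)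
      ((Multiset.toFinset_card_le _).trans h1)
    intro y hy
    rw [Finset.mem_filter, Algebra.norm_eq_zero_iff] at hy
    rw [Multiset.mem_toFinset,
      mem_roots ((Polynomial.map_ne_zero_iff (algebraMap F K).injective).2 hf0), IsRoot.def,
      eval_map_algebraMap]
    exact hy.2
  have hsplit : #{y : K | Algebra.norm F (aeval y f) = 0} +
      #{y : K | Algebra.norm F (aeval y f) ≠ 0} = P ^ 2 := by
    rw [← hK, Finset.card_filter_add_card_filter_not, Finset.card_univ]
  have hP1 : 1 ≤ P := by omega
  refine hmain.trans ?_
  rw [sub_le_iff_le_add]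
  have : D * (l + M * P + (m' - 1) * P) ≤ (1 + D * M + D * (8 * M + 24) + M) * P +
      #{y : K | Algebra.norm F (aeval y f) ≠ 0} := by
    have : M ≤ M * P := Nat.le_mul_of_pos_right _ (by omega)
    rw [add_mul _ M P]
    omega
  have h3 : (P : ℝ) = (Fintype.card F : ℝ) ^ h := by rw [hP]; push_cast; rfl
  rw [← h3]
  exact_mod_cast this
end Stepanov

/-- If `c` is finitely supported with `c 0 = 1` and satisfies Newton's identities with `S`, then
`-S` is a sequence of power sums. -/
lemma exists_eq_neg_sum_pow {c S : ℕ → ℂ} {N : ℕ} (hc0 : c 0 = 1) (hcN : ∀ d, N < d → c d = 0)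
    (hS : ∀ d, d * c d = ∑ a ∈ antidiagonal d with a.1 < d, c a.1 * S a.2) :
    ∃ ω : Fin N → ℂ, ∀ k, 0 < k → S k = -∑ j, ω j ^ k := by
  classical
  set Q : Polynomial ℂ := ∑ d ∈ range (N + 1), Polynomial.C (c d) * Polynomial.X ^ (N - d) with hQ
  have hcoeff : ∀ d ≤ N, Q.coeff (N - d) = c d := by
    intro d hd
    rw [hQ, Polynomial.finsetSum_coeff, Finset.sum_eq_single d]
    · simp
    · intro b hb hbd
      rw [Finset.mem_range] at hb
      rw [Polynomial.coeff_C_mul_X_pow, if_neg (by omega)]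
    · intro h
      simp at h; omega
  have hdeg : Q.natDegree ≤ N := by
    refine Polynomial.natDegree_sum_le_of_forall_le _ _ fun d _ => ?_
    exact (Polynomial.natDegree_C_mul_X_pow_le _ _).trans (Nat.sub_le _ _)
  have hmonic : Q.Monic := Polynomial.monic_of_natDegree_le_of_coeff_eq_one N hdeg
    (by have := hcoeff 0 (Nat.zero_le _); rwa [hc0, Nat.sub_zero] at this)
  have hdegN : Q.natDegree = N := by
    refine le_antisymm hdeg (Polynomial.le_natDegree_of_ne_zero ?_)
    have := hcoeff 0 (Nat.zero_le _)
    rw [hc0, Nat.sub_zero] at this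
    rw [this]; exact one_ne_zero
  have hcard : Q.roots.card = N := by
    rw [← hdegN]; exact (Polynomial.splits_iff_card_roots.1 (IsAlgClosed.splits Q))
  obtain ⟨ω, hω⟩ : ∃ ω : Fin N → ℂ, (Finset.univ.val.map ω) = Q.roots := by
    have hlen : Q.roots.toList.length = N := by rw [Multiset.length_toList, hcard]
    refine ⟨fun i => Q.roots.toList.get (Fin.cast hlen.symm i), ?_⟩
    rw [Fin.univ_val_map]
    conv_rhs => rw [← Multiset.coe_toList Q.roots]
    congr 1
    refine List.ext_get (by simp [hcard]) ?_
    intro i h1 h2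
    simp
  have he : ∀ d, MvPolynomial.aeval ω (MvPolynomial.esymm (Fin N) ℂ d) = (-1) ^ d * c d := by
    intro d
    rw [MvPolynomial.aeval_esymm_eq_multiset_esymm, hω]
    by_cases hd : d ≤ N
    · have h1 := Polynomial.coeff_eq_esymm_roots_of_card (p := Q) (by rw [hcard, hdegN])
        (k := N - d) (by omega)
      rw [hcoeff d hd, hmonic.leadingCoeff, one_mul, hdegN, Nat.sub_sub_self hd] at h1
      rw [h1, ← mul_assoc, ← mul_pow]
      simp
    · rw [hcN d (by omega), mul_zero, Multiset.esymm, Multiset.powersetCard_eq_empty]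
      · simp
      · omega
  have hp : ∀ k, MvPolynomial.aeval ω (MvPolynomial.psum (Fin N) ℂ k) = ∑ j, ω j ^ k := by
    intro k
    simp [MvPolynomial.psum]
  refine ⟨ω, fun k => ?_⟩
  induction k using Nat.strong_induction_on with
  | _ k ih =>
    intro hk
    have h1 := congrArg (MvPolynomial.aeval ω) (MvPolynomial.mul_esymm_eq_sum (Fin N) ℂ k)
    simp only [map_mul, map_natCast, map_sum, map_pow, map_neg, map_one, he, hp] at h1
    have h2 : (k : ℂ) * c k = -∑ a ∈ antidiagonal k with a.1 < k, c a.1 * ∑ j, ω j ^ a.2 := by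
      have h3 : ∀ (i : ℕ) (z : ℂ), (-1 : ℂ) ^ i * ((-1) ^ i * z) = z := fun i z => by
        rw [← mul_assoc, ← mul_pow]; simp
      simp only [h3] at h1
      have h4 := congrArg (fun z => (-1 : ℂ) ^ k * z) h1
      rw [mul_left_comm, h3, pow_succ, mul_assoc, h3] at h4
      rw [h4]; simp
    rw [hS k] at h2
    have hmem : ((0, k) : ℕ × ℕ) ∈ (antidiagonal k).filter fun a => a.1 < k := by
      simp [hk]
    rw [← Finset.add_sum_erase _ _ hmem, ← Finset.add_sum_erase _ _ hmem, hc0] at h2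
    have h5 : ∑ a ∈ ((antidiagonal k).filter fun a => a.1 < k).erase (0, k), c a.1 * S a.2 =
        -∑ a ∈ ((antidiagonal k).filter fun a => a.1 < k).erase (0, k),
          c a.1 * ∑ j, ω j ^ a.2 := by
      rw [← Finset.sum_neg_distrib]
      refine Finset.sum_congr rfl fun a ha => ?_
      simp only [Finset.mem_erase, Finset.mem_filter, HasAntidiagonal.mem_antidiagonal, ne_eq, Prod.ext_iff] at ha
      rw [ih a.2 (by omega) (by omega), mul_neg]
    rw [h5] at h2
    linear_combination h2

/-- Simultaneous recurrence: powers of finitely many points of the unit circle return close to `1`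
along arbitrarily large exponents. -/
lemma exists_pow_near_one {ι : Type*} [Fintype ι] (z : ι → ℂ) (hz : ∀ j, ‖z j‖ = 1) (h₀ : ℕ)
    {ε : ℝ} (hε : 0 < ε) : ∃ h ≥ h₀, ∀ j, ‖z j ^ h - 1‖ < ε := by
  have hcomp : IsCompact (Metric.closedBall (0 : ι → ℂ) 1) := isCompact_closedBall _ _
  have hmem : ∀ n : ℕ, (fun j => z j ^ n) ∈ Metric.closedBall (0 : ι → ℂ) 1 := by
    intro n
    rw [mem_closedBall_zero_iff, pi_norm_le_iff_of_nonneg zero_le_one]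
    intro j
    simp [hz]
  obtain ⟨y, -, φ, hφ, hlim⟩ := hcomp.tendsto_subseq hmem
  have hcau := hlim.cauchySeq
  obtain ⟨N, hN⟩ := Metric.cauchySeq_iff.1 hcau ε hε
  have h1 := hN (N + (φ N + h₀)) (by omega) N le_rfl
  have h2 : φ N + h₀ ≤ φ (N + (φ N + h₀)) := by
    have : N + (φ N + h₀) ≤ φ (N + (φ N + h₀)) := hφ.id_le _
    omega
  refine ⟨φ (N + (φ N + h₀)) - φ N, by omega, fun j => ?_⟩
  have h3 := (dist_le_pi_dist _ _ j).trans_lt h1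
  simp only [Function.comp_apply, dist_eq_norm] at h3
  have h4 : z j ^ φ (N + (φ N + h₀)) - z j ^ φ N =
      z j ^ φ N * (z j ^ (φ (N + (φ N + h₀)) - φ N) - 1) := by
    rw [mul_sub, ← pow_add, Nat.add_sub_cancel' (by omega), mul_one]
  rw [h4, norm_mul, norm_pow, hz, one_pow, one_mul] at h3
  exact h3

/-- Power sums of exponential growth rate at most `R` come from numbers of modulus at most `R`. -/
lemma norm_le_of_norm_sum_pow_le {ι : Type*} [Fintype ι] (z : ι → ℂ) {A R : ℝ} (hR : 0 ≤ R)
    (h₀ : ℕ) (h : ∀ n ≥ h₀, ‖∑ j, z j ^ n‖ ≤ A * R ^ n) (j : ι) : ‖z j‖ ≤ R := by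
  classical
  by_contra! hlt
  have hpos : 0 < ‖z j‖ := hR.trans_lt hlt
  have hgrow : Filter.Tendsto (fun n : ℕ => A * (R / ‖z j‖) ^ n) Filter.atTop (nhds (A * 0)) :=
    (tendsto_pow_atTop_nhds_zero_of_lt_one (by positivity)
      ((div_lt_one hpos).2 hlt)).const_mul A
  rw [mul_zero] at hgrow
  obtain ⟨n₁, hn₁⟩ := Filter.eventually_atTop.1 (hgrow.eventually_lt_const (show (0:ℝ) < 1 / 2 by norm_num))
  set u : ι → ℂ := fun i => if z i = 0 then 1 else z i / ‖z i‖ with hu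
  have hu1 : ∀ i, ‖u i‖ = 1 := by
    intro i
    simp only [hu]
    split_ifs with h0
    · simp
    · rw [norm_div, Complex.norm_real, norm_norm, div_self (norm_ne_zero_iff.2 h0)]
  obtain ⟨n, hn, hclose⟩ := exists_pow_near_one u hu1 (h₀ + n₁ + 1) (show (0:ℝ) < 1 / 2 by norm_num)
  have hre : ∀ i, ‖z i‖ ^ n / 2 ≤ (z i ^ n).re := by
    intro i
    by_cases h0 : z i = 0
    · simp [h0, show n ≠ 0 by omega]
    · have h1 : z i ^ n = ((‖z i‖ ^ n : ℝ) : ℂ) * u i ^ n := by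
        simp only [hu, if_neg h0, div_pow]
        push_cast
        rw [mul_div_cancel₀]
        exact pow_ne_zero _ (by exact_mod_cast norm_ne_zero_iff.2 h0)
      have h2 : (1:ℝ) / 2 ≤ (u i ^ n).re := by
        have h3 := (Complex.abs_re_le_norm _).trans (hclose i).le
        rw [Complex.sub_re, Complex.one_re] at h3
        linarith [(abs_le.1 h3).1]
      rw [h1, Complex.re_ofReal_mul]
      have : 0 ≤ ‖z i‖ ^ n := by positivity
      nlinarith
  have hsum : ‖z j‖ ^ n / 2 ≤ ‖∑ i, z i ^ n‖ := by
    refine le_trans ?_ (Complex.re_le_norm _)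
    rw [Complex.re_sum]
    refine (hre j).trans (Finset.single_le_sum (f := fun i => (z i ^ n).re) (fun i _ => ?_) (Finset.mem_univ j))
    exact le_trans (by positivity) (hre i)
  have h5 := hsum.trans (h n (by omega))
  have h6 := hn₁ n (by omega)
  rw [div_pow, ← mul_div_assoc, div_lt_iff₀ (by positivity)] at h6
  linarith

section LFunction
open Polynomial

variable {F : Type*} [Field F]

/-- The completely multiplicative function `f ↦ ∏ i, χ i (f (a i))` on polynomials. -/
noncomputable def evalChar {ι : Type*} [Fintype ι] (a : ι → F) (χ : ι → MulChar F ℂ) :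
    F[X] →* ℂ where
  toFun f := ∏ i, χ i (f.eval (a i))
  map_one' := by simp
  map_mul' f g := by simp [Finset.prod_mul_distrib]

lemma evalChar_apply {ι : Type*} [Fintype ι] (a : ι → F) (χ : ι → MulChar F ℂ) (f : F[X]) :
    evalChar a χ f = ∏ i, χ i (f.eval (a i)) := rfl

/-- Counting prime power divisors with multiplicity recovers the degree. -/
lemma natDegree_eq_sum_pow_dvd {d : ℕ} {f : F[X]} (hf : f.Monic) (hfd : f.natDegree = d)
    (I : Finset F[X]) (hI : ∀ P, P ∈ I ↔ P.Monic ∧ Irreducible P ∧ P.natDegree ≤ d)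
    [∀ P g : F[X], Decidable (P ∣ g)] :
    d = ∑ P ∈ I, ∑ j ∈ Icc 1 d, if P ^ j ∣ f then P.natDegree else 0 := by
  classical
  have hf0 := hf.ne_zero
  have hcount : ∀ P ∈ I, ∑ j ∈ Icc 1 d, (if P ^ j ∣ f then P.natDegree else 0) =
      (UniqueFactorizationMonoid.normalizedFactors f).count P * P.natDegree := by
    intro P hP
    obtain ⟨hPm, hPi, -⟩ := (hI P).1 hP
    have hPn : normalize P = P := hPm.normalize_eq_self
    set v := (UniqueFactorizationMonoid.normalizedFactors f).count P with hv
    have hdvd : ∀ j, P ^ j ∣ f ↔ j ≤ v := by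
      intro j
      rw [hv, pow_dvd_iff_le_emultiplicity,
        UniqueFactorizationMonoid.emultiplicity_eq_count_normalizedFactors hPi hf0, hPn]
      exact Nat.cast_le
    have hvd : v ≤ d := by
      have h1 := natDegree_le_of_dvd ((hdvd v).2 le_rfl) hf0
      rw [natDegree_pow, hfd] at h1
      exact (Nat.le_mul_of_pos_right _ hPi.natDegree_pos).trans h1
    simp_rw [hdvd]
    rw [← Finset.sum_filter, Finset.sum_const, smul_eq_mul]
    congr 1
    have : (Icc 1 d).filter (fun j => j ≤ v) = Icc 1 v := by
      ext j; simp only [Finset.mem_filter, Finset.mem_Icc]; omega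
    rw [this]; simp
  rw [Finset.sum_congr rfl hcount]
  have hprod : f = (UniqueFactorizationMonoid.normalizedFactors f).prod := by
    have h1 := UniqueFactorizationMonoid.prod_normalizedFactors_eq hf0
    rw [h1, hf.normalize_eq_self]
  have hmem : ∀ P ∈ UniqueFactorizationMonoid.normalizedFactors f, P ∈ I := by
    intro P hP
    have hPi := UniqueFactorizationMonoid.irreducible_of_normalized_factor P hP
    have hPn := UniqueFactorizationMonoid.normalize_normalized_factor P hP
    refine (hI P).2 ⟨?_, hPi, ?_⟩
    · rw [← hPn]; exact Polynomial.monic_normalize hPi.ne_zero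
    · rw [← hfd]
      exact natDegree_le_of_dvd (UniqueFactorizationMonoid.dvd_of_mem_normalizedFactors hP) hf0
  conv_lhs => rw [← hfd, hprod, natDegree_multiset_prod _
    (UniqueFactorizationMonoid.zero_notMem_normalizedFactors f),
    Finset.sum_multiset_map_count]
  simp_rw [smul_eq_mul]
  refine Finset.sum_subset (fun P hP => hmem P (Multiset.mem_toFinset.1 hP)) fun P _ hP => ?_
  rw [Multiset.mem_toFinset, ← Multiset.count_eq_zero] at hP
  rw [hP, zero_mul]

variable [Fintype F]

lemma finite_monic_natDegree_eq (d : ℕ) : {f : F[X] | f.Monic ∧ f.natDegree = d}.Finite := by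
  have : Finite (degreeLT F d) := Finite.of_equiv _ (degreeLTEquiv F d).symm.toEquiv
  exact Finite.of_equiv _ (monicEquivDegreeLT (R := F) d).symm

variable (F) in
/-- The finite set of monic polynomials of degree `d` over a finite field. -/
noncomputable def monicsOfDegree (d : ℕ) : Finset F[X] :=
  (finite_monic_natDegree_eq (F := F) d).toFinset

lemma mem_monicsOfDegree {d : ℕ} {f : F[X]} :
    f ∈ monicsOfDegree F d ↔ f.Monic ∧ f.natDegree = d := by
  simp [monicsOfDegree]

lemma monicsOfDegree_zero : monicsOfDegree F 0 = {1} := by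
  ext f
  rw [mem_monicsOfDegree, Finset.mem_singleton]
  constructor
  · rintro ⟨h1, h2⟩
    exact h1.natDegree_eq_zero.1 h2
  · rintro rfl
    exact ⟨monic_one, natDegree_one⟩

/-- The coefficients of the `L`-function vanish from the number of points on. -/
lemma sum_evalChar_eq_zero {ι : Type*} [Fintype ι] {a : ι → F} (ha : Function.Injective a)
    {χ : ι → MulChar F ℂ} (hχ : ∃ i, χ i ≠ 1) {d : ℕ} (hd : Fintype.card ι ≤ d) :
    ∑ f ∈ monicsOfDegree F d, evalChar a χ f = 0 := by
  classical
  obtain ⟨i₀, hi₀⟩ := hχ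
  obtain ⟨β, hβ⟩ := MulChar.ne_one_iff.1 hi₀
  set L : F[X] := Lagrange.basis Finset.univ a i₀ with hL
  have hinj : Set.InjOn a (Finset.univ : Finset ι) := ha.injOn
  have hLdeg : L.degree < d := by
    rw [hL, Lagrange.degree_basis hinj (Finset.mem_univ _), Finset.card_univ, Nat.cast_lt]
    have : 0 < Fintype.card ι := Fintype.card_pos_iff.2 ⟨i₀⟩
    omega
  have hLself : L.eval (a i₀) = 1 := Lagrange.eval_basis_self hinj (Finset.mem_univ _)
  have hLne : ∀ j, j ≠ i₀ → L.eval (a j) = 0 := fun j hj =>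
    Lagrange.eval_basis_of_ne hj.symm (Finset.mem_univ _)
  let φ : F → F[X] → F[X] := fun b f => f + C ((b - 1) * f.eval (a i₀)) * L
  have hφself : ∀ b f, (φ b f).eval (a i₀) = b * f.eval (a i₀) := by
    intro b f
    simp only [φ, eval_add, eval_mul, eval_C, hLself]; ring
  have hφne : ∀ b f j, j ≠ i₀ → (φ b f).eval (a j) = f.eval (a j) := by
    intro b f j hj
    simp only [φ, eval_add, eval_mul, eval_C, hLne j hj]; ring
  have hφφ : ∀ b b' f, b' * b = 1 → φ b' (φ b f) = f := by
    intro b b' f hb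
    have : φ b' (φ b f) = f + C ((b - 1) * f.eval (a i₀) + (b' - 1) * (b * f.eval (a i₀))) * L := by
      have e : φ b' (φ b f) = φ b f + C ((b' - 1) * (φ b f).eval (a i₀)) * L := rfl
      rw [e, hφself]
      simp only [φ, C_add]; ring
    rw [this, show (b - 1) * f.eval (a i₀) + (b' - 1) * (b * f.eval (a i₀)) =
      (b' * b - 1) * f.eval (a i₀) by ring, hb]
    simp
  have hφmem : ∀ b, ∀ f ∈ monicsOfDegree F d, φ b f ∈ monicsOfDegree F d := by
    intro b f hf
    rw [mem_monicsOfDegree] at hf ⊢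
    have hlt : (C ((b - 1) * f.eval (a i₀)) * L).degree < f.degree := by
      rw [degree_eq_natDegree hf.1.ne_zero, hf.2]
      exact (degree_mul_le _ _).trans_lt
        ((add_le_of_nonpos_left degree_C_le).trans_lt hLdeg)
    exact ⟨hf.1.add_of_left hlt, by rw [natDegree_add_eq_left_of_degree_lt hlt, hf.2]⟩
  have hval : ∀ f, evalChar a χ (φ β f) = χ i₀ β * evalChar a χ f := by
    intro f
    rw [evalChar_apply, evalChar_apply, ← Finset.mul_prod_erase _ _ (Finset.mem_univ i₀),
      ← Finset.mul_prod_erase _ (fun i => χ i (f.eval (a i))) (Finset.mem_univ i₀),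
      hφself, map_mul, mul_assoc]
    congr 2
    refine Finset.prod_congr rfl fun j hj => ?_
    rw [hφne _ _ j (Finset.ne_of_mem_erase hj)]
  have hsum : ∑ f ∈ monicsOfDegree F d, evalChar a χ f =
      χ i₀ β * ∑ f ∈ monicsOfDegree F d, evalChar a χ f := by
    rw [Finset.mul_sum]
    refine Finset.sum_nbij' (φ (β⁻¹ : Fˣ)) (φ β) (hφmem _) (hφmem _) ?_ ?_ ?_
    · intro f _; exact hφφ _ _ _ (by simp)
    · intro f _; exact hφφ _ _ _ (by simp)
    · intro f _
      rw [← hval, hφφ _ _ _ (by simp)]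
  have h1 : (1 - χ i₀ β) * ∑ f ∈ monicsOfDegree F d, evalChar a χ f = 0 := by
    rw [sub_mul, one_mul, ← hsum, sub_self]
  exact (mul_eq_zero.1 h1).resolve_left (sub_ne_zero.2 hβ.symm)

/-- The sum over prime powers of degree `k` occurring in Newton's identities. -/
noncomputable def primePowerSum (X : F[X] →* ℂ) (k : ℕ) : ℂ :=
  open Classical in
  ∑ P ∈ (range (k + 1)).biUnion (monicsOfDegree F) with Irreducible P ∧ P.natDegree ∣ k,
    P.natDegree * X P ^ (k / P.natDegree)

lemma mem_biUnion_monicsOfDegree {d : ℕ} {P : F[X]} [DecidableEq F[X]] :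
    P ∈ (range (d + 1)).biUnion (monicsOfDegree F) ↔ P.Monic ∧ P.natDegree ≤ d := by
  simp only [Finset.mem_biUnion, Finset.mem_range, mem_monicsOfDegree]
  constructor
  · rintro ⟨t, ht, h1, h2⟩
    exact ⟨h1, by omega⟩
  · rintro ⟨h1, h2⟩
    exact ⟨_, by omega, h1, rfl⟩

lemma sum_monicsOfDegree_dvd (X : F[X] →* ℂ) {d : ℕ} {g : F[X]} (hg : g.Monic)
    [∀ g f : F[X], Decidable (g ∣ f)] :
    ∑ f ∈ monicsOfDegree F d, (if g ∣ f then X f else 0) =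
      if g.natDegree ≤ d then X g * ∑ f ∈ monicsOfDegree F (d - g.natDegree), X f else 0 := by
  classical
  rw [← Finset.sum_filter]
  split_ifs with h
  · rw [Finset.mul_sum]
    symm
    refine Finset.sum_bij (fun f _ => g * f) ?_ ?_ ?_ ?_
    · intro f hf
      rw [mem_monicsOfDegree] at hf
      rw [Finset.mem_filter, mem_monicsOfDegree]
      refine ⟨⟨hg.mul hf.1, ?_⟩, dvd_mul_right _ _⟩
      rw [hg.natDegree_mul hf.1, hf.2]; omega
    · intro f _ f' _ hff
      exact mul_left_cancel₀ hg.ne_zero hff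
    · intro f hf
      rw [Finset.mem_filter, mem_monicsOfDegree] at hf
      obtain ⟨⟨h1, h2⟩, k, rfl⟩ := hf
      have hk := hg.of_mul_monic_left h1
      refine ⟨k, ?_, rfl⟩
      rw [mem_monicsOfDegree]
      rw [hg.natDegree_mul hk] at h2
      exact ⟨hk, by omega⟩
    · intro f _
      rw [map_mul]
  · refine Finset.sum_eq_zero fun f hf => ?_
    rw [Finset.mem_filter, mem_monicsOfDegree] at hf
    exact absurd (hf.1.2 ▸ natDegree_le_of_dvd hf.2 hf.1.1.ne_zero) h

lemma primePowerSum_eq (X : F[X] →* ℂ) {d k : ℕ} (hk : 0 < k) (hkd : k ≤ d)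
    (I : Finset F[X]) (hI : ∀ P, P ∈ I ↔ P.Monic ∧ Irreducible P ∧ P.natDegree ≤ d) :
    primePowerSum X k =
      ∑ P ∈ I, ∑ j ∈ Icc 1 d, if j * P.natDegree = k then P.natDegree * X P ^ j else 0 := by
  classical
  have hinner : ∀ P ∈ I, ∑ j ∈ Icc 1 d,
      (if j * P.natDegree = k then (P.natDegree : ℂ) * X P ^ j else 0) =
      if P.natDegree ∣ k then (P.natDegree : ℂ) * X P ^ (k / P.natDegree) else 0 := by
    intro P hP
    have hpos := ((hI P).1 hP).2.1.natDegree_pos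
    split_ifs with h
    · have h1 := Nat.div_mul_cancel h
      have h2 : 0 < k / P.natDegree := Nat.div_pos (Nat.le_of_dvd hk h) hpos
      have h3 : k / P.natDegree ≤ k := Nat.div_le_self _ _
      rw [Finset.sum_eq_single (k / P.natDegree), if_pos h1]
      · intro j _ hj
        refine if_neg fun h' => hj ?_
        rw [← h', Nat.mul_div_cancel _ hpos]
      · intro h'
        rw [Finset.mem_Icc] at h'; omega
    · refine Finset.sum_eq_zero fun j _ => if_neg ?_
      rintro rfl
      exact h (dvd_mul_left _ _)
  rw [Finset.sum_congr rfl hinner, ← Finset.sum_filter, primePowerSum]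
  refine Finset.sum_congr ?_ fun _ _ => rfl
  ext P
  rw [Finset.mem_filter, Finset.mem_filter, mem_biUnion_monicsOfDegree, hI]
  constructor
  · rintro ⟨⟨h1, h2⟩, h3, h4⟩
    exact ⟨⟨h1, h3, by omega⟩, h4⟩
  · rintro ⟨⟨h1, h2, h3⟩, h4⟩
    exact ⟨⟨h1, Nat.le_of_dvd hk h4⟩, h2, h4⟩

/-- Newton's identities for the coefficients of an `L`-function over `F[X]`. -/
lemma natCast_mul_sum_monicsOfDegree (X : F[X] →* ℂ) (d : ℕ) :
    d * ∑ f ∈ monicsOfDegree F d, X f = ∑ a ∈ antidiagonal d with a.1 < d,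
      (∑ f ∈ monicsOfDegree F a.1, X f) * primePowerSum X a.2 := by
  classical
  set c : ℕ → ℂ := fun k => ∑ f ∈ monicsOfDegree F k, X f with hc
  set I : Finset F[X] := {P ∈ (range (d + 1)).biUnion (monicsOfDegree F) | Irreducible P} with hIdef
  have hI : ∀ P, P ∈ I ↔ P.Monic ∧ Irreducible P ∧ P.natDegree ≤ d := by
    intro P
    rw [hIdef, Finset.mem_filter, mem_biUnion_monicsOfDegree]; tauto
  have hL : (d : ℂ) * c d = ∑ P ∈ I, ∑ j ∈ Icc 1 d, if j * P.natDegree ≤ d then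
      (P.natDegree : ℂ) * (X P ^ j * c (d - j * P.natDegree)) else 0 := by
    have h1 : (d : ℂ) * c d = ∑ f ∈ monicsOfDegree F d, ∑ P ∈ I, ∑ j ∈ Icc 1 d,
        (P.natDegree : ℂ) * if P ^ j ∣ f then X f else 0 := by
      rw [hc, Finset.mul_sum]
      refine Finset.sum_congr rfl fun f hf => ?_
      rw [mem_monicsOfDegree] at hf
      have h2 := natDegree_eq_sum_pow_dvd hf.1 hf.2 I hI
      have h3 : (d : ℂ) = ((∑ P ∈ I, ∑ j ∈ Icc 1 d, if P ^ j ∣ f then P.natDegree else 0 : ℕ) : ℂ) :=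
        congrArg _ h2
      rw [h3]
      push_cast
      rw [Finset.sum_mul]
      refine Finset.sum_congr rfl fun P _ => ?_
      rw [Finset.sum_mul]
      refine Finset.sum_congr rfl fun j _ => ?_
      split_ifs <;> simp
    rw [h1, Finset.sum_comm]
    refine Finset.sum_congr rfl fun P hP => ?_
    rw [Finset.sum_comm]
    refine Finset.sum_congr rfl fun j _ => ?_
    rw [← Finset.mul_sum, sum_monicsOfDegree_dvd X (((hI P).1 hP).1.pow j), natDegree_pow, map_pow,
      mul_ite, mul_zero]
  rw [hL]
  have hR : ∀ a ∈ (antidiagonal d).filter (fun a => a.1 < d), c a.1 * primePowerSum X a.2 =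
      ∑ P ∈ I, ∑ j ∈ Icc 1 d, if j * P.natDegree = a.2 then
        c a.1 * (P.natDegree * X P ^ j) else 0 := by
    intro a ha
    rw [Finset.mem_filter, HasAntidiagonal.mem_antidiagonal] at ha
    rw [primePowerSum_eq X (d := d) (by omega) (by omega) I hI, Finset.mul_sum]
    refine Finset.sum_congr rfl fun P _ => ?_
    rw [Finset.mul_sum]
    refine Finset.sum_congr rfl fun j _ => ?_
    rw [mul_ite, mul_zero]
  refine Eq.trans ?_ (Finset.sum_congr rfl hR).symm
  refine Eq.trans (Finset.sum_congr rfl fun P hP => ?_) Finset.sum_comm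
  refine Eq.trans (Finset.sum_congr rfl fun j hj => ?_) Finset.sum_comm
  have hpos : 0 < j * P.natDegree :=
    Nat.mul_pos (by rw [Finset.mem_Icc] at hj; omega) ((hI P).1 hP).2.1.natDegree_pos
  split_ifs with h
  · rw [Finset.sum_eq_single (d - j * P.natDegree, j * P.natDegree)]
    · rw [if_pos rfl]; ring
    · intro a ha hne
      refine if_neg fun h' => hne ?_
      rw [Finset.mem_filter, HasAntidiagonal.mem_antidiagonal] at ha
      ext <;> simp only <;> omega
    · intro h'
      exfalso
      apply h'
      rw [Finset.mem_filter, HasAntidiagonal.mem_antidiagonal]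
      simp only; omega
  · symm
    refine Finset.sum_eq_zero fun a ha => if_neg ?_
    rw [Finset.mem_filter, HasAntidiagonal.mem_antidiagonal] at ha
    omega

section Extension
variable {K : Type*} [Field K] [Algebra F K]

lemma norm_algebraMap_sub {F : Type*} [Field F] [Algebra F K] [FiniteDimensional F K]
    (a : F) (y : K) :
    Algebra.norm F (algebraMap F K a - y) =
      (minpoly F y).eval a ^ (Module.finrank F K / (minpoly F y).natDegree) := by
  have hy : IsIntegral F y := .of_finite F y
  set z := algebraMap F K a - y with hz
  have hzi : IsIntegral F z := .of_finite F z
  have hmin : minpoly F z =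
      ((-1) ^ (minpoly F y).natDegree * (minpoly F y).comp (-X)).comp (X - C a) := by
    rw [hz, show algebraMap F K a - y = -y + algebraMap F K a by ring, minpoly.add_algebraMap,
      minpoly.neg]
  have hdeg : (minpoly F z).natDegree = (minpoly F y).natDegree := by
    rw [hmin, natDegree_comp, natDegree_X_sub_C, mul_one,
      show ((-1) ^ (minpoly F y).natDegree : F[X]) = C ((-1) ^ (minpoly F y).natDegree) by simp,
      natDegree_C_mul (by simp), natDegree_comp, natDegree_neg, natDegree_X, mul_one]
  rw [Algebra.norm_eq_norm_adjoin F z, ← IntermediateField.adjoin.powerBasis_gen hzi,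
    Algebra.PowerBasis.norm_gen_eq_coeff_zero_minpoly, IntermediateField.adjoin.powerBasis_gen,
    ← IntermediateField.adjoin.powerBasis_gen hzi]
  have hfin : Module.finrank (IntermediateField.adjoin F {z}) K =
      Module.finrank F K / (minpoly F y).natDegree := by
    rw [← Module.finrank_mul_finrank F (IntermediateField.adjoin F {z}) K,
      IntermediateField.adjoin.finrank hzi, hdeg,
      Nat.mul_div_cancel_left _ (minpoly.natDegree_pos hy)]
  rw [hfin]
  congr 1
  rw [IntermediateField.adjoin.powerBasis_dim, hdeg, IntermediateField.adjoin.powerBasis_gen,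
    IntermediateField.minpoly_gen, hmin, coeff_zero_eq_eval_zero]
  simp only [eval_comp, eval_mul, eval_pow, eval_neg, eval_one, eval_sub, eval_X, eval_C, zero_sub,
    neg_neg]
  rw [← mul_assoc, ← mul_pow]
  simp

variable [Fintype K]

lemma card_filter_minpoly_eq {P : F[X]} (hP : P.Monic) (hPi : Irreducible P)
    (hd : P.natDegree ∣ Module.finrank F K) [DecidableEq F[X]] :
    (univ.filter fun y : K => minpoly F y = P).card = P.natDegree := by
  classical
  have hcard : Nat.card F ^ Module.finrank F K = Fintype.card K := by
    rw [← Nat.card_eq_fintype_card (α := K), Module.natCard_eq_pow_finrank (K := F) (V := K)]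
  have hdvd := (hPi.natDegree_dvd_iff_dvd_X_pow_card_pow_sub_X).1 hd
  rw [hcard] at hdvd
  have hne : (X ^ Fintype.card K - X : K[X]) ≠ 0 :=
    FiniteField.X_pow_card_sub_X_ne_zero K Fintype.one_lt_card
  have hdvd' : P.map (algebraMap F K) ∣ X ^ Fintype.card K - X := by
    have := Polynomial.map_dvd (algebraMap F K) hdvd
    simpa using this
  have hsplit : (X ^ Fintype.card K - X : K[X]).Splits := by
    rw [splits_iff_card_roots, FiniteField.roots_X_pow_card_sub_X,
      FiniteField.X_pow_card_sub_X_natDegree_eq _ Fintype.one_lt_card]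
    rfl
  have hPs := hsplit.of_dvd hne hdvd'
  have hnd : (P.map (algebraMap F K)).roots.Nodup := by
    refine Multiset.nodup_of_le (roots.le_of_dvd hne hdvd') ?_
    rw [FiniteField.roots_X_pow_card_sub_X]
    exact Finset.nodup _
  have hset : (univ.filter fun y : K => minpoly F y = P) =
      (P.map (algebraMap F K)).roots.toFinset := by
    ext y
    rw [Finset.mem_filter, Multiset.mem_toFinset, mem_roots (hP.map _).ne_zero, IsRoot.def,
      eval_map_algebraMap]
    constructor
    · rintro ⟨-, rfl⟩
      exact minpoly.aeval F y
    · intro h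
      exact ⟨Finset.mem_univ _, (minpoly.eq_of_irreducible_of_monic hPi h hP).symm⟩
  rw [hset, Multiset.toFinset_card_of_nodup hnd, ← hPs.natDegree_eq_card_roots, hP.natDegree_map]

lemma primePowerSum_evalChar {ι : Type*} [Fintype ι] (a : ι → F) (χ : ι → MulChar F ℂ)
    {k : ℕ} (hk : 0 < k) (hK : Module.finrank F K = k) :
    primePowerSum (evalChar a χ) k =
      ∑ y : K, ∏ i, χ i (Algebra.norm F (algebraMap F K (a i) - y)) := by
  classical
  have hy : ∀ y : K, ∏ i, χ i (Algebra.norm F (algebraMap F K (a i) - y)) =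
      evalChar a χ (minpoly F y) ^ (k / (minpoly F y).natDegree) := by
    intro y
    simp_rw [norm_algebraMap_sub, hK, map_pow, Finset.prod_pow, evalChar_apply]
  have hmaps : ∀ y ∈ (univ : Finset K), minpoly F y ∈
      ((range (k + 1)).biUnion (monicsOfDegree F)).filter
        (fun P => Irreducible P ∧ P.natDegree ∣ k) := by
    intro y _
    have hyi : IsIntegral F y := .of_finite F y
    have hdvd : (minpoly F y).natDegree ∣ k := hK ▸ minpoly.degree_dvd hyi
    rw [Finset.mem_filter, mem_biUnion_monicsOfDegree]
    exact ⟨⟨minpoly.monic hyi, Nat.le_of_dvd hk hdvd⟩, minpoly.irreducible hyi, hdvd⟩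
  rw [Finset.sum_congr rfl fun y _ => hy y, ← Finset.sum_fiberwise_of_maps_to hmaps, primePowerSum]
  refine Finset.sum_congr rfl fun P hP => ?_
  rw [Finset.mem_filter, mem_biUnion_monicsOfDegree] at hP
  rw [Finset.sum_congr rfl fun y hy => by rw [(Finset.mem_filter.1 hy).2], Finset.sum_const,
    card_filter_minpoly_eq hP.1.1 hP.2.1 (hK ▸ hP.2.2), nsmul_eq_mul]

end Extension
end LFunction

section Weil

variable {F ι : Type*} [Field F] [Fintype F] [Fintype ι]

/-- The Weil bound for products of multiplicative characters of distinct linear forms. -/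
theorem norm_sum_prod_mulChar_sub_le {a : ι → F} (ha : Function.Injective a)
    {χ : ι → MulChar F ℂ} (hχ : ∃ i, χ i ≠ 1) :
    ‖∑ x : F, ∏ i, χ i (a i - x)‖ ≤ (Fintype.card ι - 1 : ℕ) * √(Fintype.card F) := by
  classical
  have hι : 0 < Fintype.card ι := let ⟨i, _⟩ := hχ; Fintype.card_pos_iff.2 ⟨i⟩
  obtain ⟨ω, hω⟩ := exists_eq_neg_sum_pow
    (c := fun d => ∑ f ∈ monicsOfDegree F d, evalChar a χ f) (S := primePowerSum (evalChar a χ))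
    (N := Fintype.card ι - 1) (by simp [monicsOfDegree_zero])
    (fun d hd => sum_evalChar_eq_zero ha hχ (by omega))
    (natCast_mul_sum_monicsOfDegree _)
  obtain ⟨A, h₀, hA⟩ := exists_norm_charSum_le ha hχ
  have hroot : ∀ j, ‖ω j ^ 2‖ ≤ Fintype.card F := by
    refine norm_le_of_norm_sum_pow_le (A := A) (fun j => ω j ^ 2) (by positivity) (h₀ + 1)
      fun h hh => ?_
    let p := ringChar F
    have : Fact p.Prime := ⟨CharP.char_is_prime F p⟩
    have : NeZero (h * 2) := ⟨by omega⟩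
    have : Fintype (FiniteField.Extension F p (h * 2)) := Fintype.ofFinite _
    have h1 := hω (h * 2) (by omega)
    rw [primePowerSum_evalChar (K := FiniteField.Extension F p (h * 2)) a χ (by omega)
      (FiniteField.finrank_extension F p (h * 2))] at h1
    have h2 := hA h (by omega) (FiniteField.Extension F p (h * 2)) (by
      rw [← Nat.card_eq_fintype_card, FiniteField.natCard_extension, Nat.card_eq_fintype_card,
        pow_mul])
    rw [h1, norm_neg] at h2
    simpa only [← pow_mul, mul_comm 2 h] using h2
  have hsqrt : ∀ j, ‖ω j‖ ≤ √(Fintype.card F) := fun j =>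
    Real.le_sqrt_of_sq_le (by simpa only [norm_pow] using hroot j)
  have h1 := hω 1 one_pos
  rw [primePowerSum_evalChar (K := F) a χ one_pos (Module.finrank_self F)] at h1
  simp only [Algebra.algebraMap_self, RingHom.id_apply, Algebra.norm_self, pow_one,
    MonoidHom.id_apply] at h1
  rw [h1, norm_neg]
  refine (norm_sum_le _ _).trans ((Finset.sum_le_sum fun j _ => hsqrt j).trans ?_)
  simp

theorem norm_sum_prod_mulChar_add_le {a : ι → F} (ha : Function.Injective a)
    {χ : ι → MulChar F ℂ} (hχ : ∃ i, χ i ≠ 1) :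
    ‖∑ x : F, ∏ i, χ i (x + a i)‖ ≤ (Fintype.card ι - 1 : ℕ) * √(Fintype.card F) := by
  rw [← Equiv.sum_comp (Equiv.neg F)]
  simpa only [Equiv.neg_apply, neg_add_eq_sub] using norm_sum_prod_mulChar_sub_le ha hχ

end Weil

section CharExpansion

variable {F : Type*} [Field F] [Fintype (MulChar F ℂ)]

/-- The function `f` is a linear combination of multiplicative characters of order dividing `m`,
in which the trivial character has coefficient `c` and the coefficients have absolute values
summing to at most `M`. -/
def HasCharExpansion (f : F → ℝ) (c M : ℝ) (m : ℕ) : Prop :=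
  ∃ w : MulChar F ℂ → ℂ, (∀ x, ∑ χ, w χ * χ x = f x) ∧ w 1 = c ∧ ∑ χ, ‖w χ‖ ≤ M ∧
    ∀ χ, w χ ≠ 0 → χ ^ m = 1

namespace HasCharExpansion

open Classical in
lemma indicator_ne_zero :
    HasCharExpansion (fun x : F => if x = 0 then 0 else 1) 1 1 1 := by
  refine ⟨fun χ => if χ = 1 then 1 else 0, fun x => ?_, by simp, ?_, by simp⟩
  · simp only [ite_mul, one_mul, zero_mul, Finset.sum_ite_eq', Finset.mem_univ, if_true]
    split_ifs with h
    · rw [h, MulChar.map_zero]; simp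
    · rw [MulChar.one_apply (isUnit_iff_ne_zero.2 h)]; simp
  · have : ∀ χ : MulChar F ℂ, ‖(if χ = 1 then 1 else 0 : ℂ)‖ = if χ = 1 then 1 else 0 := by
      intro χ; split_ifs <;> simp
    simp [this]

lemma sub_smul {f g : F → ℝ} {c c' M M' r : ℝ} {m m' : ℕ} (hr : 0 ≤ r)
    (hf : HasCharExpansion f c M m) (hg : HasCharExpansion g c' M' m') (hm : m ∣ m') :
    HasCharExpansion (fun x => r * f x - g x) (r * c - c') (r * M + M') m' := by
  obtain ⟨w, h1, h2, h3, h4⟩ := hf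
  obtain ⟨v, g1, g2, g3, g4⟩ := hg
  refine ⟨fun χ => r * w χ - v χ, fun x => ?_, by simp [h2, g2], ?_, fun χ hχ => ?_⟩
  · push_cast
    rw [← h1, ← g1, Finset.mul_sum, ← Finset.sum_sub_distrib]
    exact Finset.sum_congr rfl fun χ _ => by ring
  · calc ∑ χ, ‖(r : ℂ) * w χ - v χ‖ ≤ ∑ χ, (r * ‖w χ‖ + ‖v χ‖) :=
          Finset.sum_le_sum fun χ _ => (norm_sub_le _ _).trans_eq
            (by rw [norm_mul, Complex.norm_real, Real.norm_of_nonneg hr])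
      _ = r * ∑ χ, ‖w χ‖ + ∑ χ, ‖v χ‖ := by rw [Finset.sum_add_distrib, Finset.mul_sum]
      _ ≤ r * M + M' := by gcongr
  · by_cases hv : v χ = 0
    · have hw : w χ ≠ 0 := by
        intro hw
        simp [hv, hw] at hχ
      obtain ⟨k, rfl⟩ := hm
      rw [pow_mul, h4 χ hw, one_pow]
    · exact g4 χ hv

open Classical in
lemma twist {f : F → ℝ} {c M : ℝ} {m l : ℕ} (hf : HasCharExpansion f c M m) (hl : l.Prime)
    (hlm : ¬ l ∣ m) {X : MulChar F ℂ} (hX : orderOf X = l) :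
    HasCharExpansion (fun x => f x * ((if X x = 1 then 1 else 0) - 1 / l)) 0
      ((1 - 1 / l) * M) (m * l) := by
  obtain ⟨w, h1, h2, h3, h4⟩ := hf
  have hl0 : (l : ℂ) ≠ 0 := Nat.cast_ne_zero.2 hl.ne_zero
  have hXl : X ^ l = 1 := hX ▸ pow_orderOf_eq_one X
  have hf0 : f 0 = 0 := by
    have := h1 0
    simp only [MulChar.map_zero, mul_zero, Finset.sum_const_zero] at this
    exact_mod_cast this.symm
  refine ⟨fun χ => 1 / l * ∑ j ∈ Ico 1 l, w ((X ^ j)⁻¹ * χ), fun x => ?_, ?_, ?_, ?_⟩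
  · by_cases hx : x = 0
    · simp [hx, hf0, MulChar.map_zero]
    have hshift : ∀ j ∈ Ico 1 l, ∑ χ, w ((X ^ j)⁻¹ * χ) * χ x = X x ^ j * f x := by
      intro j hj
      rw [Finset.mem_Ico] at hj
      rw [← h1, Finset.mul_sum, ← Equiv.sum_comp (Equiv.mulLeft (X ^ j))]
      refine Finset.sum_congr rfl fun χ _ => ?_
      rw [Equiv.coe_mulLeft, inv_mul_cancel_left, MulChar.mul_apply,
        MulChar.pow_apply' _ (by omega)]
      ring
    have hgeom : ∑ j ∈ Ico 1 l, X x ^ j = (if X x = 1 then (l : ℂ) else 0) - 1 := by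
      have e1 : ∑ j ∈ range l, X x ^ j = if X x = 1 then (l : ℂ) else 0 := by
        split_ifs with h
        · simp [h]
        · have e2 := mul_geom_sum (X x) l
          rw [← MulChar.pow_apply' _ hl.ne_zero, hXl,
            MulChar.one_apply (isUnit_iff_ne_zero.2 hx), sub_self] at e2
          exact (mul_eq_zero.1 e2).resolve_left (sub_ne_zero.2 h)
      rw [← e1, Finset.range_eq_Ico, Finset.sum_eq_sum_Ico_succ_bot hl.pos]
      simp
    calc ∑ χ, 1 / (l : ℂ) * (∑ j ∈ Ico 1 l, w ((X ^ j)⁻¹ * χ)) * χ x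
        = 1 / (l : ℂ) * ∑ j ∈ Ico 1 l, ∑ χ, w ((X ^ j)⁻¹ * χ) * χ x := by
          rw [Finset.sum_comm, Finset.mul_sum]
          refine Finset.sum_congr rfl fun χ _ => ?_
          rw [mul_assoc, Finset.sum_mul]
      _ = 1 / (l : ℂ) * ∑ j ∈ Ico 1 l, X x ^ j * f x := by rw [Finset.sum_congr rfl hshift]
      _ = _ := by
          rw [← Finset.sum_mul, hgeom]
          beta_reduce
          by_cases h : X x = 1
          · rw [if_pos h, if_pos h]; push_cast; field_simp
          · rw [if_neg h, if_neg h]; push_cast; field_simp; ring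
  · have : ∑ j ∈ Ico 1 l, w ((X ^ j)⁻¹ * 1) = 0 := by
      refine Finset.sum_eq_zero fun j hj => ?_
      rw [Finset.mem_Ico] at hj
      by_contra h
      have h5 := h4 _ h
      rw [mul_one, inv_pow, inv_eq_one, ← pow_mul, ← orderOf_dvd_iff_pow_eq_one, hX] at h5
      rcases hl.dvd_mul.1 h5 with h6 | h6
      · exact absurd (Nat.le_of_dvd (by omega) h6) (by omega)
      · exact hlm h6
    simp only [this, mul_zero, Complex.ofReal_zero]
  · calc ∑ χ, ‖1 / (l : ℂ) * ∑ j ∈ Ico 1 l, w ((X ^ j)⁻¹ * χ)‖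
        ≤ ∑ χ, 1 / (l : ℝ) * ∑ j ∈ Ico 1 l, ‖w ((X ^ j)⁻¹ * χ)‖ := by
          refine Finset.sum_le_sum fun χ _ => ?_
          rw [norm_mul, norm_div, norm_one, Complex.norm_natCast]
          gcongr
          exact norm_sum_le _ _
      _ = 1 / (l : ℝ) * ∑ j ∈ Ico 1 l, ∑ χ, ‖w ((X ^ j)⁻¹ * χ)‖ := by
          rw [Finset.sum_comm, Finset.mul_sum]
      _ = 1 / (l : ℝ) * ∑ j ∈ Ico 1 l, ∑ χ, ‖w χ‖ := by
          congr 1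
          exact Finset.sum_congr rfl fun j _ =>
            Equiv.sum_comp (Equiv.mulLeft (X ^ j)⁻¹) fun χ => ‖w χ‖
      _ = (1 - 1 / l) * ∑ χ, ‖w χ‖ := by
          have : (l : ℝ) ≠ 0 := Nat.cast_ne_zero.2 hl.ne_zero
          rw [Finset.sum_const, Nat.card_Ico, nsmul_eq_mul, Nat.cast_sub hl.one_le]
          push_cast
          field_simp
      _ ≤ (1 - 1 / l) * M := by
          have : (1 : ℝ) / l ≤ 1 := by
            rw [div_le_one (by exact_mod_cast hl.pos)]
            exact_mod_cast hl.one_le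
          gcongr
  · intro χ hχ
    obtain ⟨j, -, hj⟩ := Finset.exists_ne_zero_of_sum_ne_zero (right_ne_zero_of_mul hχ)
    have h5 := h4 _ hj
    have h6 : χ ^ m = (X ^ j) ^ m := by
      rw [mul_pow, inv_pow] at h5
      rwa [inv_mul_eq_one, eq_comm] at h5
    rw [pow_mul, h6, ← pow_mul, ← pow_mul, ← mul_assoc, mul_comm (j * m), pow_mul, hXl, one_pow]

open Classical in
lemma indicator_forall_ne_one (T : Finset ℕ) (X : ℕ → MulChar F ℂ)
    (hT : ∀ l ∈ T, l.Prime ∧ orderOf (X l) = l) :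
    HasCharExpansion (fun x : F => if x ≠ 0 ∧ ∀ l ∈ T, X l x ≠ 1 then 1 else 0)
      (∏ l ∈ T, (1 - 1 / (l : ℝ))) ((∏ l ∈ T, (1 - 1 / (l : ℝ))) * 2 ^ T.card) (∏ l ∈ T, l) := by
  induction T using Finset.induction_on with
  | empty => simpa using indicator_ne_zero (F := F)
  | insert l T hl ih =>
    have h1 := ih fun r hr => hT r (Finset.mem_insert_of_mem hr)
    obtain ⟨hlp, hlX⟩ := hT l (Finset.mem_insert_self l T)
    have hndvd : ¬ l ∣ ∏ r ∈ T, r := by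
      intro h
      obtain ⟨r, hr, hlr⟩ := (hlp.prime.dvd_finsetProd_iff _).1 h
      exact hl ((Nat.prime_dvd_prime_iff_eq hlp (hT r (Finset.mem_insert_of_mem hr)).1).1 hlr ▸ hr)
    have hr : (0 : ℝ) ≤ 1 - 1 / l := by
      rw [sub_nonneg, div_le_one (by exact_mod_cast hlp.pos)]
      exact_mod_cast hlp.one_le
    have h2 := h1.sub_smul hr (h1.twist hlp hndvd hlX) (dvd_mul_right _ _)
    rw [Finset.prod_insert hl, Finset.prod_insert hl, Finset.card_insert_of_notMem hl,
      mul_comm l]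
    convert h2 using 1
    · ext x
      by_cases hx : X l x = 1 <;> by_cases hx' : x ≠ 0 ∧ ∀ r ∈ T, X r x ≠ 1
      · simp [hx, hx']
      · simp [hx, hx']
      · have : x ≠ 0 ∧ ∀ r ∈ insert l T, X r x ≠ 1 :=
          ⟨hx'.1, Finset.forall_mem_insert _ _ _ |>.2 ⟨hx, hx'.2⟩⟩
        rw [if_pos this, if_pos hx', if_neg hx]; ring
      · have : ¬ (x ≠ 0 ∧ ∀ r ∈ insert l T, X r x ≠ 1) := fun h =>
          hx' ⟨h.1, fun r hr => h.2 r (Finset.mem_insert_of_mem hr)⟩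
        rw [if_neg this, if_neg hx']; ring
    · ring
    · ring

lemma abs_sum_prod_sub_le [Fintype F] {n : ℕ} (hn : 3 ≤ n) (hnq : n ≤ Fintype.card F) {b : Fin n → F}
    (hb : Function.Injective b) {f : Fin n → F → ℝ} {c M : Fin n → ℝ} {m : Fin n → ℕ}
    (hf : ∀ k, HasCharExpansion (f k) (c k) (M k) (m k)) :
    |∑ x, ∏ k, f k (x + b k) - (∏ k, c k) * Fintype.card F| ≤
      (∏ k, M k) * ((n - 1) * √(Fintype.card F)) := by
  classical
  choose w h1 h2 h3 _ using hf
  set E : ℝ := (n - 1) * √(Fintype.card F) with hE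
  have hn3 : (3 : ℝ) ≤ n := by exact_mod_cast hn
  have hE0 : 0 ≤ E := mul_nonneg (by linarith) (Real.sqrt_nonneg _)
  have hterm : ∀ ψ : Fin n → MulChar F ℂ,
      ‖∑ x, ∏ k, ψ k (x + b k) - if ψ = 1 then (Fintype.card F : ℂ) else 0‖ ≤ E := by
    intro ψ
    split_ifs with hψ
    · subst hψ
      have hx : ∀ x : F, ∏ k, (1 : Fin n → MulChar F ℂ) k (x + b k) =
          1 - if x ∈ univ.image (fun k => -b k) then 1 else 0 := by
        intro x
        split_ifs with h
        · obtain ⟨k, -, rfl⟩ := Finset.mem_image.1 h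
          rw [sub_self]
          exact Finset.prod_eq_zero (Finset.mem_univ k) (by simp [MulChar.map_zero])
        · rw [sub_zero]
          refine Finset.prod_eq_one fun k _ => MulChar.one_apply (isUnit_iff_ne_zero.2 fun h0 => h ?_)
          exact Finset.mem_image.2 ⟨k, Finset.mem_univ k, (eq_neg_of_add_eq_zero_left h0).symm⟩
      have hcard : (univ.image (fun k => -b k)).card ≤ n :=
        Finset.card_image_le.trans (by simp)
      rw [Finset.sum_congr rfl fun x _ => hx x, Finset.sum_sub_distrib, Finset.sum_const,
        Finset.card_univ, nsmul_eq_mul, mul_one, Finset.sum_ite_mem, Finset.univ_inter,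
        Finset.sum_const, nsmul_eq_mul, mul_one, sub_sub_cancel_left, norm_neg,
        Complex.norm_natCast]
      refine le_trans (Nat.cast_le.2 hcard) ?_
      have h3q : (3 / 2 : ℝ) ≤ √(Fintype.card F) := by
        refine Real.le_sqrt_of_sq_le ?_
        have : (3 : ℝ) ≤ Fintype.card F := by exact_mod_cast hn.trans hnq
        linarith
      rw [hE]
      nlinarith
    · rw [sub_zero]
      have hex : ∃ k, ψ k ≠ 1 := by
        by_contra! h
        exact hψ (funext h)
      have h4 := norm_sum_prod_mulChar_add_le hb hex
      rw [Fintype.card_fin, Nat.cast_sub (by omega), Nat.cast_one] at h4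
      exact h4
  have hexp : ((∑ x, ∏ k, f k (x + b k) - (∏ k, c k) * Fintype.card F : ℝ) : ℂ) =
      ∑ ψ : Fin n → MulChar F ℂ, (∏ k, w k (ψ k)) *
        (∑ x, ∏ k, ψ k (x + b k) - if ψ = 1 then (Fintype.card F : ℂ) else 0) := by
    simp_rw [mul_sub, Finset.sum_sub_distrib, mul_ite, mul_zero]
    rw [Finset.sum_ite_eq' _ _ _, if_pos (Finset.mem_univ _)]
    push_cast
    simp_rw [← h1, ← h2, Pi.one_apply, Finset.mul_sum]
    congr 1
    rw [Finset.sum_comm]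
    refine Finset.sum_congr rfl fun x _ => ?_
    rw [Finset.prod_univ_sum, Fintype.piFinset_univ]
    exact Finset.sum_congr rfl fun ψ _ => Finset.prod_mul_distrib
  rw [← Real.norm_eq_abs, ← Complex.norm_real, hexp]
  calc _ ≤ ∑ ψ : Fin n → MulChar F ℂ, (∏ k, ‖w k (ψ k)‖) * E := by
        refine (norm_sum_le _ _).trans (Finset.sum_le_sum fun ψ _ => ?_)
        rw [norm_mul, norm_prod]
        gcongr
        exact hterm ψ
    _ = (∏ k, ∑ χ, ‖w k χ‖) * E := by
        rw [← Finset.sum_mul, Finset.prod_univ_sum, Fintype.piFinset_univ]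
    _ ≤ (∏ k, M k) * E := by
        gcongr with k
        exact h3 k

end HasCharExpansion

end CharExpansion

lemma isPrimitiveElem_of_mulChar_ne_one {F : Type*} [Field F] [Fintype F] {X : ℕ → MulChar F ℂ}
    (hX : ∀ l, l.Prime → l ∣ Fintype.card F - 1 → orderOf (X l) = l) {x : F} (hx : x ≠ 0)
    (h : ∀ l, l.Prime → l ∣ Fintype.card F - 1 → X l x ≠ 1) : IsPrimitiveElem x := by
  classical
  obtain ⟨γ, hγ⟩ := IsCyclic.exists_monoid_generator (α := Fˣ)
  obtain ⟨t, ht⟩ := Submonoid.mem_powers_iff _ _ |>.1 (hγ (Units.mk0 x hx))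
  have hxt : x = (γ : F) ^ t := by
    rw [← Units.val_pow_eq_pow_val, ht, Units.val_mk0]
  have hcop : (Nat.card Fˣ).Coprime t := by
    refine Nat.coprime_of_dvd fun l hl h1 ⟨r, hr⟩ => ?_
    rw [Nat.card_eq_fintype_card, Fintype.card_units] at h1
    refine h l hl h1 ?_
    rw [hxt, hr, mul_comm, pow_mul, map_pow, ← MulChar.pow_apply' _ hl.ne_zero]
    have h2 := pow_orderOf_eq_one (X l)
    rw [hX l hl h1] at h2
    rw [h2, ← Units.val_pow_eq_pow_val, MulChar.one_apply_coe]
  intro y hy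
  obtain ⟨v, hv⟩ := (powCoprime hcop).surjective (Units.mk0 y hy)
  obtain ⟨r, hr⟩ := Submonoid.mem_powers_iff _ _ |>.1 (hγ v)
  rw [powCoprime_apply] at hv
  refine ⟨r, ?_⟩
  rw [hxt, ← pow_mul, mul_comm, pow_mul, ← Units.val_pow_eq_pow_val, ← Units.val_pow_eq_pow_val, hr,
    hv, Units.val_mk0]

/-- Main sieving criterion: let `e ∣ q-1` and let `p₁, …, p_s` be the distinct primes
dividing `q-1` but not `e` (so `s = 0` and `δ = 1` when `Rad(e) = Rad(q-1)`), and set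
`δ = 1 - n ∑ᵢ 1/pᵢ`. If `δ > 0` and `q > ((n-1)((ns-1)/δ + 2) W(e)ⁿ)²`, then `𝔽_q`
contains `n` consecutive primitive elements. -/
theorem consecutive_primitives_of_sieve (q c n s : ℕ) (hq : IsPrimePow q)
    (F : Type*) [Field F] [Fintype F] (hF : Fintype.card F = q) (hc : CharP F c)
    (hn3 : 3 ≤ n) (hnc : n ≤ c) (e : ℕ) (he : e ∣ q - 1)
    (p : Fin s → ℕ) (hprime : ∀ i, (p i).Prime) (hdvd : ∀ i, p i ∣ q - 1)
    (hnot : ∀ i, ¬ p i ∣ e) (hinj : Function.Injective p)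
    (hall : ∀ r : ℕ, r.Prime → r ∣ q - 1 → ¬ r ∣ e → ∃ i, p i = r)
    (δ : ℝ) (hδdef : δ = 1 - (n : ℝ) * ∑ i : Fin s, 1 / (p i : ℝ)) (hδ : 0 < δ)
    (hbound : (q : ℝ) >
      (((n : ℝ) - 1) * (((n : ℝ) * s - 1) / δ + 2) * (W e : ℝ) ^ n) ^ 2) :
    HasConsecutivePrimitives F n := by
  classical
  have hcF : Nat.Prime c := (CharP.char_is_prime_or_zero F c).resolve_right (by omega)
  subst hF
  have hnq : n ≤ Fintype.card F := by
    obtain ⟨m, -, hm⟩ := FiniteField.card F c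
    rw [hm]
    exact hnc.trans (Nat.le_self_pow m.ne_zero c)
  have hq1 : Fintype.card F - 1 ≠ 0 := by omega
  have he0 : e ≠ 0 := by
    rintro rfl
    exact hq1 (zero_dvd_iff.1 he)
  have hXex : ∀ l : ℕ, ∃ X : MulChar F ℂ, l.Prime → l ∣ Fintype.card F - 1 → orderOf X = l := by
    intro l
    by_cases hl : l.Prime ∧ l ∣ Fintype.card F - 1
    · obtain ⟨X, hX⟩ := MulChar.exists_mulChar_orderOf F hl.2
        (Complex.isPrimitiveRoot_exp l hl.1.ne_zero)
      exact ⟨X, fun _ _ => hX⟩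
    · exact ⟨1, fun h1 h2 => absurd ⟨h1, h2⟩ hl⟩
  choose X hX using hXex
  have : Fintype (MulChar F ℂ) := Fintype.ofFinite _
  let b : Fin n → F := fun k => ((k : ℕ) : F)
  have hb : Function.Injective b := fun i j hij => Fin.ext
    (CharP.natCast_injOn_Iio F c (i.2.trans_le hnc) (j.2.trans_le hnc) hij)
  set T := e.primeFactors with hT
  set f : F → ℝ := fun x => if x ≠ 0 ∧ ∀ l ∈ T, X l x ≠ 1 then 1 else 0 with hf
  set θ := theta e with hθ
  have hTp : ∀ l ∈ T, l.Prime ∧ orderOf (X l) = l := fun l hl =>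
    ⟨Nat.prime_of_mem_primeFactors hl, hX l (Nat.prime_of_mem_primeFactors hl)
      ((Nat.dvd_of_mem_primeFactors hl).trans he)⟩
  have hfe : HasCharExpansion f θ (θ * W e) (∏ l ∈ T, l) := by
    have := HasCharExpansion.indicator_forall_ne_one T X hTp
    simpa only [W, hθ, theta, Nat.cast_pow, Nat.cast_ofNat] using this
  have hθ0 : 0 < θ := by
    refine Finset.prod_pos fun l hl => ?_
    have : (1 : ℝ) < l := by exact_mod_cast (hTp l hl).1.one_lt
    rw [sub_pos, div_lt_one (by linarith)]
    exact this
  set Q : ℝ := √(Fintype.card F) with hQ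
  have hQQ : Q * Q = Fintype.card F := Real.mul_self_sqrt (Nat.cast_nonneg _)
  set B : ℝ := (θ * W e) ^ n * ((n - 1) * Q) with hB
  set N : ℝ := ∑ x, ∏ k, f (x + b k) with hN
  have hmain : |N - θ ^ n * Fintype.card F| ≤ B := by
    have := HasCharExpansion.abs_sum_prod_sub_le hn3 hnq hb (fun _ => hfe)
    simpa only [Finset.prod_const, Finset.card_univ, Fintype.card_fin] using this
  have hsieve : ∀ (k : Fin n) (i : Fin s),
      ∑ x, (∏ j, f (x + b j)) * (if X (p i) (x + b k) = 1 then 1 else 0) ≤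
        1 / p i * N + (1 - 1 / p i) * B := by
    intro k i
    have hndvd : ¬ p i ∣ ∏ l ∈ T, l := fun h => hnot i (h.trans (Nat.prod_primeFactors_dvd e))
    have htw := hfe.twist (hprime i) hndvd (hX _ (hprime i) (hdvd i))
    have key := HasCharExpansion.abs_sum_prod_sub_le hn3 hnq hb
      (f := fun j => if j = k then
        (fun x => f x * ((if X (p i) x = 1 then 1 else 0) - 1 / (p i : ℝ))) else f)
      (c := fun j => if j = k then 0 else θ)
      (M := fun j => (if j = k then 1 - 1 / (p i : ℝ) else 1) * (θ * W e))
      (m := fun j => if j = k then (∏ l ∈ T, l) * p i else ∏ l ∈ T, l) (by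
        intro j
        by_cases hj : j = k
        · simpa only [hj, if_true] using htw
        · simpa only [hj, if_false, one_mul] using hfe)
    have hp1 : ∀ x, ∏ j, (if j = k then
        (fun x => f x * ((if X (p i) x = 1 then 1 else 0) - 1 / (p i : ℝ))) else f) (x + b j) =
        (∏ j, f (x + b j)) * (if X (p i) (x + b k) = 1 then 1 else 0) -
          1 / p i * ∏ j, f (x + b j) := by
      intro x
      have : ∀ j, (if j = k then
          (fun x => f x * ((if X (p i) x = 1 then 1 else 0) - 1 / (p i : ℝ))) else f) (x + b j) =
          f (x + b j) * if j = k then (if X (p i) (x + b k) = 1 then 1 else 0) - 1 / (p i : ℝ)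
            else 1 := by
        intro j
        by_cases hj : j = k
        · subst hj
          simp only [if_true]
        · simp only [hj, if_false, mul_one]
      rw [Finset.prod_congr rfl fun j _ => this j, Finset.prod_mul_distrib,
        Fintype.prod_ite_eq']
      ring
    have hc0 : ∏ j, (if j = k then 0 else θ) = 0 :=
      Finset.prod_eq_zero (Finset.mem_univ k) (if_pos rfl)
    rw [Finset.sum_congr rfl fun x _ => hp1 x, Finset.sum_sub_distrib, ← Finset.mul_sum,
      hc0, zero_mul, sub_zero,
      Finset.prod_mul_distrib, Fintype.prod_ite_eq', Finset.prod_const, Finset.card_univ,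
      Fintype.card_fin, mul_assoc, ← hB, ← hN] at key
    linarith [(abs_le.1 key).2]
  obtain ⟨g, hg0, hg1⟩ : ∃ g, (∀ k, f (g + b k) = 1) ∧ ∀ k i, X (p i) (g + b k) ≠ 1 := by
    by_contra! hcon
    have hf01 : ∀ x, f x = 0 ∨ f x = 1 := by
      intro x
      simp only [hf]
      split_ifs <;> simp
    have hle : N ≤ ∑ k, ∑ i, ∑ x, (∏ j, f (x + b j)) *
        (if X (p i) (x + b k) = 1 then 1 else 0) := by
      have : ∀ x, ∏ j, f (x + b j) ≤ ∑ k, ∑ i, (∏ j, f (x + b j)) *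
          (if X (p i) (x + b k) = 1 then 1 else 0) := by
        intro x
        by_cases hx : ∀ k, f (x + b k) = 1
        · obtain ⟨k, i, hki⟩ := hcon x hx
          have h1 : ∏ j, f (x + b j) = 1 := Finset.prod_eq_one fun j _ => hx j
          simp only [h1, one_mul]
          have hnn : ∀ k' i', (0 : ℝ) ≤ if X (p i') (x + b k') = 1 then 1 else 0 := by
            intro k' i'
            split_ifs <;> norm_num
          refine le_trans ?_ (Finset.single_le_sum
            (fun k' _ => Finset.sum_nonneg fun i' _ => hnn k' i') (Finset.mem_univ k))
          refine le_trans ?_ (Finset.single_le_sum (fun i' _ => hnn k i') (Finset.mem_univ i))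
          rw [if_pos hki]
        · push Not at hx
          obtain ⟨k, hk⟩ := hx
          have h0 : ∏ j, f (x + b j) = 0 :=
            Finset.prod_eq_zero (Finset.mem_univ k) ((hf01 _).resolve_right hk)
          simp [h0]
      refine (Finset.sum_le_sum fun x _ => this x).trans_eq ?_
      rw [Finset.sum_comm]
      exact Finset.sum_congr rfl fun k _ => Finset.sum_comm
    have hle2 : N ≤ (1 - δ) * N + (n * s - (1 - δ)) * B := by
      refine hle.trans ((Finset.sum_le_sum fun k _ => Finset.sum_le_sum fun i _ =>
        hsieve k i).trans_eq ?_)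
      simp only [Finset.sum_add_distrib, ← Finset.sum_mul, Finset.sum_const, Finset.card_univ,
        Fintype.card_fin, nsmul_eq_mul, Finset.sum_sub_distrib, mul_one]
      rw [hδdef]
      ring
    have hlt : ((n : ℝ) - 1) * (((n : ℝ) * s - 1) / δ + 2) * (W e : ℝ) ^ n < Q :=
      Real.lt_sqrt_of_sq_lt hbound
    have hQ0 : 0 < Q := Real.sqrt_pos.2 (by exact_mod_cast Fintype.card_pos)
    have hkey : (n * s - 1 + 2 * δ) * B < δ * (θ ^ n * Fintype.card F) := by
      have h1 : (n * s - 1 + 2 * δ) * B = δ * θ ^ n * Q *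
          (((n : ℝ) - 1) * (((n : ℝ) * s - 1) / δ + 2) * (W e : ℝ) ^ n) := by
        rw [hB, mul_pow]
        field_simp
      rw [h1, ← hQQ, show δ * (θ ^ n * (Q * Q)) = δ * θ ^ n * Q * Q by ring]
      exact mul_lt_mul_of_pos_left hlt (by positivity)
    have h2 := (abs_le.1 hmain).1
    nlinarith
  have hfree : ∀ k, g + b k ≠ 0 ∧ ∀ l ∈ T, X l (g + b k) ≠ 1 := by
    intro k
    by_contra h
    have := hg0 k
    simp only [hf, if_neg h] at this
    exact zero_ne_one this
  refine ⟨g, fun k hk => ?_, fun i hi j hj hij => ?_⟩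
  · refine isPrimitiveElem_of_mulChar_ne_one hX (hfree ⟨k, hk⟩).1 fun l hl hld => ?_
    by_cases hle : l ∣ e
    · exact (hfree ⟨k, hk⟩).2 l (Nat.mem_primeFactors.2 ⟨hl, hle, he0⟩)
    · obtain ⟨i, rfl⟩ := hall l hl hld hle
      exact hg1 ⟨k, hk⟩ i
  · exact CharP.natCast_injOn_Iio F c (hi.trans_le hnc) (hj.trans_le hnc) (add_left_cancel hij)
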